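/- arXiv:1404.0890 — 3 statements merged into one kernel-verified Lean document; each statement's English description precedes it below -/
import Mathlib

section
/- (Lyons' universal limit theorem, existence and uniqueness of solution paths, 2≤p<3.) Let E be a Banach space, V a C²_b vector field and V₁,…,V_ℓ C³_b vector fields on E, and let (X,𝕏) be a weak geometric Hölder p-rough path over ℝ^ℓ on [0,T], 2≤p<3. Call a path z : [0,T] → E a solution path to the rough differential equation dz = V dt + F X(dt) with initial condition x if z₀ = x and there exist constants a>1, δ>0 and c≥0 such that for every bounded C³ function f : E → ℝ with bounded derivatives and all 0≤s≤t≤T with t−s≤δ: |f(z_t) − f(z_s) − (t−s)(Vf)(z_s) − X^i_{ts}(V_if)(z_s) − 𝕏^{jk}_{ts}(V_jV_kf)(z_s)| ≤ c‖f‖_{C³}|t−s|^a. Then for every x∈E there exists exactly one solution path with initial condition x. -/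
/-!
Statement 16: Lyons' universal limit theorem — existence and uniqueness of solution
paths to a rough differential equation, 2 ≤ p < 3 (theorem 4.6).
-/

noncomputable section

variable {E : Type*} [NormedAddCommGroup E] [NormedSpace ℝ E] [CompleteSpace E]

/-- A vector field (or function) is `C^k_b` if it is `C^k`, bounded, with bounded
derivatives up to order `k`. -/
def CkbMap (k : ℕ) {F : Type*} [NormedAddCommGroup F] [NormedSpace ℝ F]
    (W : E → F) : Prop :=
  ContDiff ℝ k W ∧ ∀ i ≤ k, ∃ M : ℝ, ∀ x : E, ‖iteratedFDeriv ℝ i W x‖ ≤ M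

/-- The Lie bracket `[V_j, V_k] = DV_k (V_j) - DV_j (V_k)` of two vector fields. -/
def bracket (Vj Vk : E → E) : E → E :=
  fun y => fderiv ℝ Vk y (Vj y) - fderiv ℝ Vj y (Vk y)

/-- The driving vector field
`y ↦ (t-s) V(y) + X^i_{ts} V_i(y) + ½ 𝕏^{jk}_{ts} [V_j, V_k](y)` of the ODE whose
time-1 map defines `μ_{ts}`. -/
def rdeDriver (ℓ : ℕ) (V : E → E) (Vf : Fin ℓ → E → E)
    (Xts : EuclideanSpace ℝ (Fin ℓ)) (XXts : EuclideanSpace ℝ (Fin ℓ × Fin ℓ))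
    (Δ : ℝ) : E → E :=
  fun y => Δ • V y + (∑ i : Fin ℓ, Xts i • Vf i y) +
    (2⁻¹ : ℝ) • ∑ j : Fin ℓ, ∑ k : Fin ℓ, XXts (j, k) • bracket (Vf j) (Vf k) y

/-- `‖f‖_{C³}`: the sum of the supremum norms of `f` and its first three derivatives. -/
def C3norm (f : E → ℝ) : ℝ :=
  ∑ i ∈ Finset.range 4, ⨆ x : E, ‖iteratedFDeriv ℝ i f x‖

/-- `z` is a solution path of the rough differential equation
`dz = V dt + F X(dt)` with initial condition `x₀`: `z₀ = x₀` and `z` admits a uniform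
Taylor–Euler expansion of order `a > 1` along `(X, 𝕏)`, tested against all `C³_b`
functions `f : E → ℝ`. -/
def IsSolutionPath (ℓ : ℕ) (T : ℝ) (V : E → E) (Vf : Fin ℓ → E → E)
    (X : ℝ → ℝ → EuclideanSpace ℝ (Fin ℓ))
    (XX : ℝ → ℝ → EuclideanSpace ℝ (Fin ℓ × Fin ℓ))
    (x₀ : E) (z : ℝ → E) : Prop :=
  z 0 = x₀ ∧
  ∃ a > (1:ℝ), ∃ δ > (0:ℝ), ∃ c : ℝ, 0 ≤ c ∧
    ∀ f : E → ℝ, CkbMap 3 f →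
    ∀ s t : ℝ, 0 ≤ s → s ≤ t → t ≤ T → t - s ≤ δ →
      |f (z t) - f (z s) - (t - s) * fderiv ℝ f (z s) (V (z s))
          - (∑ i : Fin ℓ, X t s i * fderiv ℝ f (z s) (Vf i (z s)))
          - ∑ j : Fin ℓ, ∑ k : Fin ℓ, XX t s (j, k) *
              fderiv ℝ (fun y => fderiv ℝ f y (Vf k y)) (z s) (Vf j (z s))| ≤
        c * C3norm f * (t - s) ^ a

set_option linter.unusedSectionVars false

section Control

variable {E : Type*} [NormedAddCommGroup E] [NormedSpace ℝ E]
  {F : Type*} [NormedAddCommGroup F] [NormedSpace ℝ F]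

/-- `U` is bounded by `B` and `B`-Lipschitz. -/
def BddLip (B : ℝ) (U : E → F) : Prop :=
  (∀ x, ‖U x‖ ≤ B) ∧ ∀ x y, ‖U x - U y‖ ≤ B * ‖x - y‖

/-- `U` is bounded, Lipschitz, and its second differences are bilinearly bounded, all with
constant `B`. -/
def BddC11 (B : ℝ) (U : E → F) : Prop :=
  BddLip B U ∧ ∀ a c r, ‖(U (a + r) - U a) - (U (c + r) - U c)‖ ≤ B * ‖r‖ * ‖a - c‖

/-- First-order Taylor remainder of `U` at `x` with increment `h`. -/
def taylorRem (U : E → F) (x h : E) : F := U (x + h) - U x - fderiv ℝ U x h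

/-- `U` is `BddC11`, its derivative is `BddLip`, and its first-order Taylor remainder is
Lipschitz in both variables with the natural orders, all with constant `B`. -/
def BddC21 (B : ℝ) (U : E → F) : Prop :=
  BddC11 B U ∧ BddLip B (fderiv ℝ U) ∧
    (∀ x h, ‖taylorRem U x h‖ ≤ B * ‖h‖ ^ 2) ∧
    (∀ x y h, ‖taylorRem U x h - taylorRem U y h‖ ≤ B * ‖h‖ ^ 2 * ‖x - y‖) ∧
    ∀ e x h k, ‖h‖ ≤ e → ‖k‖ ≤ e → ‖taylorRem U x h - taylorRem U x k‖ ≤ B * e * ‖h - k‖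

theorem BddLip.nonneg {B : ℝ} {U : E → F} (hU : BddLip B U) : 0 ≤ B :=
  (norm_nonneg _).trans (hU.1 0)

theorem BddLip.mono {B B' : ℝ} {U : E → F} (hU : BddLip B U) (h : B ≤ B') : BddLip B' U :=
  ⟨fun x => (hU.1 x).trans h, fun x y => (hU.2 x y).trans (by gcongr)⟩

theorem BddC11.mono {B B' : ℝ} {U : E → F} (hU : BddC11 B U) (h : B ≤ B') : BddC11 B' U :=
  ⟨hU.1.mono h, fun a c r => (hU.2 a c r).trans (by gcongr)⟩

theorem BddC21.mono {B B' : ℝ} {U : E → F} (hU : BddC21 B U) (h : B ≤ B') : BddC21 B' U := by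
  obtain ⟨h1, h2, h3, h4, h5⟩ := hU
  refine ⟨h1.mono h, h2.mono h, fun x k => (h3 x k).trans (by gcongr),
    fun x y k => (h4 x y k).trans (by gcongr), fun e x k l hk hl => (h5 e x k l hk hl).trans ?_⟩
  have : 0 ≤ e := (norm_nonneg k).trans hk
  gcongr

theorem BddLip.add {B B' : ℝ} {U W : E → F} (hU : BddLip B U) (hW : BddLip B' W) :
    BddLip (B + B') (fun x => U x + W x) := by
  refine ⟨fun x => (norm_add_le _ _).trans (add_le_add (hU.1 x) (hW.1 x)), fun x y => ?_⟩
  rw [add_sub_add_comm, add_mul]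
  exact (norm_add_le _ _).trans (add_le_add (hU.2 x y) (hW.2 x y))

theorem BddLip.smul {B : ℝ} {U : E → F} (hU : BddLip B U) (c : ℝ) :
    BddLip (|c| * B) (fun x => c • U x) := by
  refine ⟨fun x => ?_, fun x y => ?_⟩
  · rw [norm_smul, Real.norm_eq_abs]
    exact mul_le_mul_of_nonneg_left (hU.1 x) (abs_nonneg c)
  · rw [← smul_sub, norm_smul, Real.norm_eq_abs, mul_assoc]
    exact mul_le_mul_of_nonneg_left (hU.2 x y) (abs_nonneg c)

theorem BddLip.zero : BddLip 0 (fun _ : E => (0 : F)) := by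
  constructor <;> simp

theorem BddLip.sum_smul {ι : Type*} (s : Finset ι) {B : ℝ} {U : ι → E → F} (c : ι → ℝ)
    (hU : ∀ i, BddLip B (U i)) :
    BddLip ((∑ i ∈ s, |c i|) * B) (fun x => ∑ i ∈ s, c i • U i x) := by
  classical
  induction s using Finset.induction_on with
  | empty => simpa using BddLip.zero
  | insert i s hi ih =>
    simp only [Finset.sum_insert hi, add_mul]
    exact ((hU i).smul (c i)).add ih

theorem BddC11.add {B B' : ℝ} {U W : E → F} (hU : BddC11 B U) (hW : BddC11 B' W) :
    BddC11 (B + B') (fun x => U x + W x) := by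
  refine ⟨hU.1.add hW.1, fun a c r => ?_⟩
  calc ‖(U (a + r) + W (a + r) - (U a + W a)) - (U (c + r) + W (c + r) - (U c + W c))‖
      = ‖((U (a + r) - U a) - (U (c + r) - U c)) + ((W (a + r) - W a) - (W (c + r) - W c))‖ := by
        congr 1; abel
    _ ≤ B * ‖r‖ * ‖a - c‖ + B' * ‖r‖ * ‖a - c‖ :=
        (norm_add_le _ _).trans (add_le_add (hU.2 a c r) (hW.2 a c r))
    _ = (B + B') * ‖r‖ * ‖a - c‖ := by ring

theorem BddC11.smul {B : ℝ} {U : E → F} (hU : BddC11 B U) (c : ℝ) :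
    BddC11 (|c| * B) (fun x => c • U x) := by
  refine ⟨hU.1.smul c, fun a d r => ?_⟩
  rw [← smul_sub, ← smul_sub, ← smul_sub, norm_smul, Real.norm_eq_abs, mul_assoc, mul_assoc,
    ← mul_assoc B]
  exact mul_le_mul_of_nonneg_left (hU.2 a d r) (abs_nonneg c)

theorem BddC11.zero : BddC11 0 (fun _ : E => (0 : F)) :=
  ⟨BddLip.zero, by simp⟩

theorem BddC11.sum_smul {ι : Type*} (s : Finset ι) {B : ℝ} {U : ι → E → F} (c : ι → ℝ)
    (hU : ∀ i, BddC11 B (U i)) :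
    BddC11 ((∑ i ∈ s, |c i|) * B) (fun x => ∑ i ∈ s, c i • U i x) := by
  classical
  induction s using Finset.induction_on with
  | empty => simpa using BddC11.zero
  | insert i s hi ih =>
    simp only [Finset.sum_insert hi, add_mul]
    exact ((hU i).smul (c i)).add ih

theorem BddC11.increment {B e : ℝ} {U : E → F} {g : E → E} (hU : BddC11 B U)
    (hg : BddLip e g) : BddLip (2 * B * e) (fun x => U (x + g x) - U x) := by
  have hB := hU.1.nonneg
  have he := hg.nonneg
  refine ⟨fun x => ?_, fun x y => ?_⟩
  · have h1 := hU.1.2 (x + g x) x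
    rw [add_sub_cancel_left] at h1
    have h2 := mul_le_mul_of_nonneg_left (hg.1 x) hB
    nlinarith [mul_nonneg hB he]
  · calc ‖U (x + g x) - U x - (U (y + g y) - U y)‖
        = ‖((U (x + g x) - U x) - (U (y + g x) - U y)) + (U (y + g x) - U (y + g y))‖ := by
          congr 1; abel
      _ ≤ B * ‖g x‖ * ‖x - y‖ + B * ‖(y + g x) - (y + g y)‖ :=
          (norm_add_le _ _).trans (add_le_add (hU.2 x y (g x)) (hU.1.2 _ _))
      _ ≤ B * e * ‖x - y‖ + B * (e * ‖x - y‖) := by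
          rw [add_sub_add_left_eq_sub]
          gcongr
          · exact hg.1 x
          · exact hg.2 x y
      _ = 2 * B * e * ‖x - y‖ := by ring

theorem BddC21.taylorRem_bddLip {B e : ℝ} {U : E → F} {g : E → E} (hU : BddC21 B U)
    (hg : BddLip e g) : BddLip (2 * B * e ^ 2) (fun x => taylorRem U x (g x)) := by
  obtain ⟨h1, -, h3, h4, h5⟩ := hU
  have hB := h1.1.nonneg
  have he := hg.nonneg
  refine ⟨fun x => ?_, fun x y => ?_⟩
  · calc ‖taylorRem U x (g x)‖ ≤ B * ‖g x‖ ^ 2 := h3 _ _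
      _ ≤ B * e ^ 2 := by gcongr; exact hg.1 x
      _ ≤ 2 * B * e ^ 2 := by nlinarith [mul_nonneg hB (sq_nonneg e)]
  · calc ‖taylorRem U x (g x) - taylorRem U y (g y)‖
        = ‖(taylorRem U x (g x) - taylorRem U y (g x)) +
            (taylorRem U y (g x) - taylorRem U y (g y))‖ := by congr 1; abel
      _ ≤ B * ‖g x‖ ^ 2 * ‖x - y‖ + B * e * ‖g x - g y‖ :=
          (norm_add_le _ _).trans (add_le_add (h4 _ _ _) (h5 e _ _ _ (hg.1 x) (hg.1 y)))
      _ ≤ B * e ^ 2 * ‖x - y‖ + B * e * (e * ‖x - y‖) := by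
          gcongr
          · exact hg.1 x
          · exact hg.2 x y
      _ = 2 * B * e ^ 2 * ‖x - y‖ := by ring

theorem BddLip.clm_apply {B e : ℝ} {A : E → E →L[ℝ] F} {v : E → E} (hA : BddLip B A)
    (hv : BddLip e v) : BddLip (2 * B * e) (fun x => A x (v x)) := by
  have hB := hA.nonneg
  have he := hv.nonneg
  refine ⟨fun x => ?_, fun x y => ?_⟩
  · calc ‖A x (v x)‖ ≤ ‖A x‖ * ‖v x‖ := (A x).le_opNorm _
      _ ≤ B * e := by gcongr; exacts [hA.1 x, hv.1 x]
      _ ≤ 2 * B * e := by nlinarith [mul_nonneg hB he]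
  · calc ‖A x (v x) - A y (v y)‖ = ‖(A x - A y) (v x) + A y (v x - v y)‖ := by
          congr 1; simp
      _ ≤ ‖A x - A y‖ * ‖v x‖ + ‖A y‖ * ‖v x - v y‖ :=
          (norm_add_le _ _).trans (add_le_add ((A x - A y).le_opNorm _) ((A y).le_opNorm _))
      _ ≤ (B * ‖x - y‖) * e + B * (e * ‖x - y‖) := by
          gcongr
          exacts [hA.2 x y, hv.1 x, hA.1 y, hv.2 x y]
      _ = 2 * B * e * ‖x - y‖ := by ring

theorem norm_image_sub_le_of_fderiv_bound {f : E → F} (hf : Differentiable ℝ f) {C : ℝ}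
    (hC : ∀ x, ‖fderiv ℝ f x‖ ≤ C) (x y : E) : ‖f x - f y‖ ≤ C * ‖x - y‖ :=
  convex_univ.norm_image_sub_le_of_norm_fderiv_le (fun z _ => hf z) (fun z _ => hC z)
    (Set.mem_univ y) (Set.mem_univ x)

theorem bddLip_of_fderiv_bound {f : E → F} (hf : Differentiable ℝ f) {C : ℝ}
    (h0 : ∀ x, ‖f x‖ ≤ C) (hC : ∀ x, ‖fderiv ℝ f x‖ ≤ C) : BddLip C f :=
  ⟨h0, norm_image_sub_le_of_fderiv_bound hf hC⟩

theorem fderiv_comp_add_sub {f : E → F} (hf : Differentiable ℝ f) (r a : E) :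
    HasFDerivAt (fun z => f (z + r) - f z) (fderiv ℝ f (a + r) - fderiv ℝ f a) a :=
  ((hasFDerivAt_comp_add_right r).2 (hf (a + r)).hasFDerivAt).sub (hf a).hasFDerivAt

theorem bddC11_of_fderiv_bddLip {f : E → F} (hf : Differentiable ℝ f) {C : ℝ}
    (h0 : ∀ x, ‖f x‖ ≤ C) (hC : BddLip C (fderiv ℝ f)) : BddC11 C f := by
  refine ⟨bddLip_of_fderiv_bound hf h0 hC.1, fun a c r => ?_⟩
  refine norm_image_sub_le_of_fderiv_bound (f := fun z => f (z + r) - f z)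
    (fun z => (fderiv_comp_add_sub hf r z).differentiableAt) (fun z => ?_) a c
  rw [(fderiv_comp_add_sub hf r z).fderiv]
  simpa using hC.2 (z + r) z

theorem norm_taylorRem_sub_le {U : E → F} (hU : Differentiable ℝ U) {C e : ℝ}
    (hC : BddLip C (fderiv ℝ U)) {x h k : E} (hh : ‖h‖ ≤ e) (hk : ‖k‖ ≤ e) :
    ‖taylorRem U x h - taylorRem U x k‖ ≤ C * e * ‖h - k‖ := by
  have hd : ∀ z, HasFDerivAt (taylorRem U x) (fderiv ℝ U (x + z) - fderiv ℝ U x) z := fun z =>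
    (((hasFDerivAt_comp_add_left x).2 (hU (x + z)).hasFDerivAt).sub_const (U x)).sub
      (fderiv ℝ U x).hasFDerivAt
  refine (convex_closedBall (0 : E) e).norm_image_sub_le_of_norm_fderiv_le (𝕜 := ℝ)
    (fun z _ => (hd z).differentiableAt) (fun z hz => ?_) (by simpa using hk) (by simpa using hh)
  rw [(hd z).fderiv]
  refine (hC.2 (x + z) x).trans ?_
  have : ‖z‖ ≤ e := by simpa using hz
  simpa using mul_le_mul_of_nonneg_left this hC.nonneg

theorem norm_taylorRem_le {U : E → F} (hU : Differentiable ℝ U) {C : ℝ}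
    (hC : BddLip C (fderiv ℝ U)) (x h : E) : ‖taylorRem U x h‖ ≤ C * ‖h‖ ^ 2 := by
  have := norm_taylorRem_sub_le hU hC (x := x) (le_refl ‖h‖) (k := 0) (by simp)
  simpa [taylorRem, sq, mul_assoc] using this

theorem bddC21_of_fderiv_bddLip {f : E → F} (hf : Differentiable ℝ f)
    (hf' : Differentiable ℝ (fderiv ℝ f)) {C : ℝ} (h0 : ∀ x, ‖f x‖ ≤ C)
    (h1 : BddLip C (fderiv ℝ f)) (h2 : BddLip C (fderiv ℝ (fderiv ℝ f))) : BddC21 C f := by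
  refine ⟨bddC11_of_fderiv_bddLip hf h0 h1, h1, norm_taylorRem_le hf h1, fun x y h => ?_,
    fun e x h k => norm_taylorRem_sub_le hf h1⟩
  have hd : ∀ z, HasFDerivAt (fun z => taylorRem f z h)
      (fderiv ℝ f (z + h) - fderiv ℝ f z - (fderiv ℝ (fderiv ℝ f) z).flip h) z := fun z => by
    refine (fderiv_comp_add_sub hf h z).sub ?_
    exact ((hf' z).hasFDerivAt.clm_apply (hasFDerivAt_const h z)).congr_fderiv (by ext; simp)
  refine norm_image_sub_le_of_fderiv_bound (f := fun z => taylorRem f z h)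
    (fun z => (hd z).differentiableAt) (fun z => ?_) x y
  rw [(hd z).fderiv]
  have hsymm : (fderiv ℝ (fderiv ℝ f) z).flip h = fderiv ℝ (fderiv ℝ f) z h := by
    ext k
    exact second_derivative_symmetric (fun y => (hf y).hasFDerivAt) (hf' z).hasFDerivAt k h
  rw [hsymm]
  exact norm_taylorRem_le hf' h2 z h

theorem CkbMap.differentiable {k : ℕ} {U : E → F} (hU : CkbMap k U) (hk : k ≠ 0) :
    Differentiable ℝ U :=
  hU.1.differentiable (by exact_mod_cast hk)

theorem CkbMap.fderiv_right {k : ℕ} {U : E → F} (hU : CkbMap (k + 1) U) : CkbMap k (fderiv ℝ U) := by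
  refine ⟨hU.1.fderiv_right (by norm_cast), fun i hi => ?_⟩
  obtain ⟨M, hM⟩ := hU.2 (i + 1) (by omega)
  exact ⟨M, fun x => norm_iteratedFDeriv_fderiv.trans_le (hM x)⟩

theorem CkbMap.of_le {k m : ℕ} {U : E → F} (hU : CkbMap k U) (h : m ≤ k) : CkbMap m U :=
  ⟨hU.1.of_le (by exact_mod_cast h), fun i hi => hU.2 i (hi.trans h)⟩

theorem CkbMap.clm_apply {k : ℕ} {A : E → E →L[ℝ] F} {v : E → E} (hA : CkbMap k A)
    (hv : CkbMap k v) : CkbMap k (fun x => A x (v x)) := by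
  refine ⟨hA.1.clm_apply hv.1, fun i hi => ?_⟩
  choose! M hM using hA.2
  choose! N hN using hv.2
  refine ⟨∑ j ∈ Finset.range (i + 1), (i.choose j) * M j * N (i - j), fun x => ?_⟩
  refine (norm_iteratedFDeriv_clm_apply hA.1 hv.1 x (by exact_mod_cast hi)).trans ?_
  refine Finset.sum_le_sum fun j hj => ?_
  have hj' : j ≤ k := by simp at hj; omega
  have h1 := hM j hj' x
  have h2 := hN (i - j) (by omega) x
  have h3 : 0 ≤ M j := (norm_nonneg _).trans h1
  gcongr

theorem CkbMap.bounded {k : ℕ} {U : E → F} (hU : CkbMap k U) : ∃ M, ∀ x, ‖U x‖ ≤ M := by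
  obtain ⟨M, hM⟩ := hU.2 0 (Nat.zero_le _)
  exact ⟨M, fun x => by simpa using hM x⟩

theorem CkbMap.exists_bddLip {U : E → F} (hU : CkbMap 1 U) : ∃ B, BddLip B U := by
  obtain ⟨M, hM⟩ := hU.bounded
  obtain ⟨N, hN⟩ := hU.fderiv_right.bounded
  exact ⟨max M N, bddLip_of_fderiv_bound (hU.differentiable one_ne_zero)
    (fun x => (hM x).trans (le_max_left _ _)) fun x => (hN x).trans (le_max_right _ _)⟩

theorem CkbMap.exists_bddC11 {U : E → F} (hU : CkbMap 2 U) : ∃ B, BddC11 B U := by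
  obtain ⟨M, hM⟩ := hU.bounded
  obtain ⟨N, hN⟩ := hU.fderiv_right.exists_bddLip
  exact ⟨max M N, bddC11_of_fderiv_bddLip (hU.differentiable two_ne_zero)
    (fun x => (hM x).trans (le_max_left _ _)) (hN.mono (le_max_right _ _))⟩

theorem CkbMap.exists_bddC21 {U : E → F} (hU : CkbMap 3 U) : ∃ B, BddC21 B U := by
  obtain ⟨M, hM⟩ := hU.bounded
  obtain ⟨N, hN⟩ := (hU.fderiv_right.of_le one_le_two).exists_bddLip
  obtain ⟨P, hP⟩ := hU.fderiv_right.fderiv_right.exists_bddLip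
  exact ⟨max M (max N P), bddC21_of_fderiv_bddLip (hU.differentiable three_ne_zero)
    (hU.fderiv_right.differentiable two_ne_zero)
    (fun x => (hM x).trans (le_max_left _ _))
    (hN.mono ((le_max_left _ _).trans (le_max_right _ _)))
    (hP.mono ((le_max_right _ _).trans (le_max_right _ _)))⟩

end Control

section AlmostFlow

variable {E : Type*} [NormedAddCommGroup E] [NormedSpace ℝ E]

/-- The maps `x ↦ x + g t s x`, `0 ≤ s ≤ t ≤ T`, are `C^{1,1}`-close to the identity and form a
flow up to a Lipschitz-small defect of order `a`. -/
structure AlmostFlow (T K b a : ℝ) (g : ℝ → ℝ → E → E) : Prop where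
  bddC11 : ∀ s t : ℝ, 0 ≤ s → s ≤ t → t ≤ T → BddC11 (K * (t - s) ^ b) (g t s)
  defect : ∀ s u t : ℝ, 0 ≤ s → s ≤ u → u ≤ t → t ≤ T →
    BddLip (K * (t - s) ^ a) (fun x => g u s x + g t u (x + g u s x) - g t s x)

/-- `n` steps of the scheme `x ↦ x + g t s x` along the grid of mesh `h`, from the grid point of
index `i`. -/
def eulerFlow (g : ℝ → ℝ → E → E) (h : ℝ) (i : ℕ) : ℕ → E → E
  | 0, x => x
  | n + 1, x => eulerFlow g h i n x +
      g ((i + n + 1 : ℕ) * h) ((i + n : ℕ) * h) (eulerFlow g h i n x)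

theorem eulerFlow_add (g : ℝ → ℝ → E → E) (h : ℝ) (i m n : ℕ) (x : E) :
    eulerFlow g h i (m + n) x = eulerFlow g h (i + m) n (eulerFlow g h i m x) := by
  induction n with
  | zero => rfl
  | succ n ih =>
    change eulerFlow g h i (m + n) x + g ((i + (m + n) + 1 : ℕ) * h) ((i + (m + n) : ℕ) * h)
      (eulerFlow g h i (m + n) x) = _
    rw [ih, ← add_assoc]
    rfl

theorem BddLip.comp {ρ L : ℝ} {R Φ : E → E} (hR : BddLip ρ R) (hL : 1 ≤ L)
    (hΦ : ∀ x y, ‖Φ x - Φ y‖ ≤ L * ‖x - y‖) : BddLip (ρ * L) (fun x => R (Φ x)) := by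
  have hρ := hR.nonneg
  refine ⟨fun x => (hR.1 _).trans (le_mul_of_one_le_right hρ hL), fun x y => ?_⟩
  calc ‖R (Φ x) - R (Φ y)‖ ≤ ρ * ‖Φ x - Φ y‖ := hR.2 _ _
    _ ≤ ρ * (L * ‖x - y‖) := by gcongr; exact hΦ x y
    _ = ρ * L * ‖x - y‖ := by ring

theorem BddC11.perturbation {κ ρ : ℝ} {g g₁ R : E → E} (hg : BddC11 κ g) (hg₁ : BddLip κ g₁)
    (hκ : κ ≤ 1) (hR : BddLip ρ R) :
    BddLip (3 * κ * ρ) (fun x => g (x + g₁ x + R x) - g (x + g₁ x)) := by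
  have hκ0 := hg₁.nonneg
  have hρ := hR.nonneg
  have hκρ := mul_nonneg hκ0 hρ
  refine ⟨fun x => ?_, fun x y => ?_⟩
  · have h1 := hg.1.2 (x + g₁ x + R x) (x + g₁ x)
    rw [add_sub_cancel_left] at h1
    have h2 := mul_le_mul_of_nonneg_left (hR.1 x) hκ0
    linarith
  · have hz : ‖(x + g₁ x) - (y + g₁ y)‖ ≤ 2 * ‖x - y‖ := by
      rw [add_sub_add_comm]
      refine (norm_add_le _ _).trans ?_
      have := hg₁.2 x y
      nlinarith [norm_nonneg (x - y)]
    calc ‖g (x + g₁ x + R x) - g (x + g₁ x) - (g (y + g₁ y + R y) - g (y + g₁ y))‖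
        = ‖((g (x + g₁ x + R x) - g (x + g₁ x)) - (g (y + g₁ y + R x) - g (y + g₁ y))) +
            (g (y + g₁ y + R x) - g (y + g₁ y + R y))‖ := by congr 1; abel
      _ ≤ κ * ‖R x‖ * ‖(x + g₁ x) - (y + g₁ y)‖ +
            κ * ‖(y + g₁ y + R x) - (y + g₁ y + R y)‖ :=
          (norm_add_le _ _).trans (add_le_add (hg.2 _ _ _) (hg.1.2 _ _))
      _ ≤ κ * ρ * (2 * ‖x - y‖) + κ * (ρ * ‖x - y‖) := by
          rw [add_sub_add_left_eq_sub]
          gcongr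
          exacts [hR.1 x, hR.2 x y]
      _ = 3 * κ * ρ * ‖x - y‖ := by ring

theorem rpow_add_rpow_le_of_le_two_thirds {a u v : ℝ} (ha : 1 < a) (hu : 0 ≤ u) (hv : 0 ≤ v)
    (hu' : u ≤ 2 / 3 * (u + v)) (hv' : v ≤ 2 / 3 * (u + v)) :
    u ^ a + v ^ a ≤ (2 / 3 : ℝ) ^ (a - 1) * (u + v) ^ a := by
  have key : ∀ w, 0 ≤ w → w ≤ 2 / 3 * (u + v) →
      w ^ a ≤ w * ((2 / 3 : ℝ) ^ (a - 1) * (u + v) ^ (a - 1)) := by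
    intro w hw hw'
    rw [← Real.mul_rpow (by norm_num) (by positivity)]
    calc w ^ a = w * w ^ (a - 1) := by
          rw [mul_comm, ← Real.rpow_add_one' hw (by linarith), sub_add_cancel]
      _ ≤ _ := by
          refine mul_le_mul_of_nonneg_left (Real.rpow_le_rpow hw hw' (by linarith)) hw
  have h1 : (u + v) ^ a = (u + v) * (u + v) ^ (a - 1) := by
    rw [mul_comm, ← Real.rpow_add_one' (by positivity) (by linarith), sub_add_cancel]
  rw [h1]
  linarith [key u hu hu', key v hv hv']

namespace AlmostFlow

variable {T K b a : ℝ} {g : ℝ → ℝ → E → E}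

theorem K_nonneg (hg : AlmostFlow T K b a g) (hT : 0 < T) : 0 ≤ K := by
  have := (hg.bddC11 0 T le_rfl hT.le le_rfl).1.nonneg
  rw [sub_zero] at this
  exact nonneg_of_mul_nonneg_left this (by positivity)

theorem eulerFlow_sub_bddLip (hg : AlmostFlow T K b a g) (hK : 0 ≤ K) (hb : 0 < b) (ha : 1 < a)
    {C δ : ℝ} (hC : 0 ≤ C) (hδ : 0 ≤ δ) (hsmall : K * δ ^ b ≤ 1)
    (hclose : (2 / 3 : ℝ) ^ (a - 1) * (1 + 3 * (K * δ ^ b) + C * δ ^ a) * C + K ≤ C)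
    {h : ℝ} (hh : 0 ≤ h) :
    ∀ n i : ℕ, n * h ≤ δ → (i + n : ℕ) * h ≤ T →
      BddLip (C * (n * h) ^ a)
        (fun x => eulerFlow g h i n x - (x + g ((i + n : ℕ) * h) (i * h) x)) := by
  intro n
  induction n using Nat.strong_induction_on with
  | _ n ih =>
  intro i hn hi
  have hnn : (0 : ℝ) ≤ C * (n * h) ^ a := by positivity
  rcases Nat.lt_or_ge n 2 with hn2 | hn2
  · have hz : (fun x => eulerFlow g h i n x - (x + g ((i + n : ℕ) * h) (i * h) x)) =
        fun _ => 0 := by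
      funext x
      interval_cases n
      · have := (hg.bddC11 (i * h) (i * h) (by positivity) le_rfl (by simpa using hi)).1.1 x
        rw [sub_self, Real.zero_rpow hb.ne', mul_zero] at this
        simp [eulerFlow, norm_le_zero_iff.1 this]
      · simp [eulerFlow]
    rw [hz]
    exact BddLip.zero.mono hnn
  · obtain ⟨m, k, hm, hk, hmk, hm3, hk3⟩ : ∃ m k : ℕ, 1 ≤ m ∧ 1 ≤ k ∧ n = m + k ∧
        3 * m ≤ 2 * n ∧ 3 * k ≤ 2 * n :=
      ⟨n / 2, n - n / 2, by omega, by omega, by omega, by omega, by omega⟩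
    subst hmk
    set κ := K * δ ^ b with hκ
    have hm0 : (0 : ℝ) ≤ m * h := by positivity
    have hk0 : (0 : ℝ) ≤ k * h := by positivity
    have hmkh : ((m + k : ℕ) : ℝ) * h = m * h + k * h := by push_cast; ring
    have hmδ : m * h ≤ δ := by linarith
    have hkδ : k * h ≤ δ := by linarith
    have hs0 : (0 : ℝ) ≤ i * h := by positivity
    have hsu : (i * h : ℝ) ≤ (i + m : ℕ) * h := by push_cast; nlinarith
    have hut : ((i + m : ℕ) * h : ℝ) ≤ (i + (m + k) : ℕ) * h := by push_cast; nlinarith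
    have R1 := ih m (by omega) i hmδ (hut.trans hi)
    have R2 := ih k (by omega) (i + m) hkδ (by rw [add_assoc]; exact hi)
    have g1 := (hg.bddC11 _ _ hs0 hsu (hut.trans hi)).mono (B' := κ) (by
      rw [hκ]
      refine mul_le_mul_of_nonneg_left (Real.rpow_le_rpow (by linarith) ?_ hb.le) hK
      push_cast; linarith)
    have g2 := (hg.bddC11 _ _ (hs0.trans hsu) hut hi).mono (B' := κ) (by
      rw [hκ]
      refine mul_le_mul_of_nonneg_left (Real.rpow_le_rpow (by linarith) ?_ hb.le) hK
      push_cast; linarith)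
    have d := hg.defect _ _ _ hs0 hsu hut hi
    have hκ0 : 0 ≤ κ := g1.1.nonneg
    have hCδ : 0 ≤ C * δ ^ a := by positivity
    have hmδa : C * (m * h) ^ a ≤ C * δ ^ a := by gcongr
    have hΦ : ∀ x y, ‖eulerFlow g h i m x - eulerFlow g h i m y‖ ≤
        (1 + κ + C * δ ^ a) * ‖x - y‖ := by
      intro x y
      have e1 := R1.2 x y
      have e2 := g1.1.2 x y
      have e3 := mul_le_mul_of_nonneg_right hmδa (norm_nonneg (x - y))
      have : eulerFlow g h i m x - eulerFlow g h i m y = (x - y) +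
          (g ((i + m : ℕ) * h) (i * h) x - g ((i + m : ℕ) * h) (i * h) y) +
          ((eulerFlow g h i m x - (x + g ((i + m : ℕ) * h) (i * h) x)) -
            (eulerFlow g h i m y - (y + g ((i + m : ℕ) * h) (i * h) y))) := by abel
      rw [this]
      refine (norm_add₃_le).trans ?_
      linarith
    have t1 := R2.comp (by linarith) hΦ
    have t2 := R1.add (g2.perturbation g1.1 hsmall R1)
    have tot := (t1.add t2).add d
    have hbound : C * (k * h) ^ a * (1 + κ + C * δ ^ a) +
        (C * (m * h) ^ a + 3 * κ * (C * (m * h) ^ a)) +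
        K * ((i + (m + k) : ℕ) * h - i * h) ^ a ≤ C * ((m + k : ℕ) * h) ^ a := by
      have e1 : ((i + (m + k) : ℕ) * h - i * h : ℝ) = (m + k : ℕ) * h := by push_cast; ring
      rw [e1]
      set ω := ((m + k : ℕ) * h : ℝ) with hω
      have hω0 : 0 ≤ ω ^ a := Real.rpow_nonneg (by positivity) _
      have hm3' : (3 * m : ℝ) ≤ 2 * (m + k) := by exact_mod_cast hm3
      have hk3' : (3 * k : ℝ) ≤ 2 * (m + k) := by exact_mod_cast hk3
      have e2 := rpow_add_rpow_le_of_le_two_thirds ha hm0 hk0 (by nlinarith) (by nlinarith)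
      rw [← hmkh] at e2
      have hma : 0 ≤ (m * h : ℝ) ^ a := by positivity
      have hka : 0 ≤ (k * h : ℝ) ^ a := by positivity
      have e3 := mul_le_mul_of_nonneg_right hclose hω0
      have e4 := mul_le_mul_of_nonneg_left e2
        (show 0 ≤ (1 + 3 * κ + C * δ ^ a) * C by positivity)
      nlinarith [mul_nonneg (mul_nonneg hC hka) hκ0, mul_nonneg (mul_nonneg hC hma) hCδ]
    refine BddLip.mono ?_ hbound
    convert tot using 2 with x
    rw [eulerFlow_add]
    have : x + g ((i + m : ℕ) * h) (i * h) x +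
        (eulerFlow g h i m x - (x + g ((i + m : ℕ) * h) (i * h) x)) = eulerFlow g h i m x := by
      abel
    simp only [this, add_assoc i m k]
    abel

theorem eulerFlow_lipschitz_of_le (hg : AlmostFlow T K b a g) (hK : 0 ≤ K) (hb : 0 < b)
    (ha : 1 < a) {C δ : ℝ} (hC : 0 ≤ C) (hδ : 0 ≤ δ) (hsmall : K * δ ^ b ≤ 1)
    (hclose : (2 / 3 : ℝ) ^ (a - 1) * (1 + 3 * (K * δ ^ b) + C * δ ^ a) * C + K ≤ C)
    {h : ℝ} (hh : 0 ≤ h) {n i : ℕ} (hn : n * h ≤ δ) (hi : (i + n : ℕ) * h ≤ T) (x y : E) :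
    ‖eulerFlow g h i n x - eulerFlow g h i n y‖ ≤ (1 + K * δ ^ b + C * δ ^ a) * ‖x - y‖ := by
  have e1 := (hg.eulerFlow_sub_bddLip hK hb ha hC hδ hsmall hclose hh n i hn hi).2 x y
  have hs : (i * h : ℝ) ≤ (i + n : ℕ) * h := by push_cast; nlinarith [n.cast_nonneg (α := ℝ)]
  have e2 := (hg.bddC11 _ _ (by positivity) hs hi).1.2 x y
  have e3 : ((i + n : ℕ) * h - i * h : ℝ) = n * h := by push_cast; ring
  rw [e3] at e2
  have e4 : K * (n * h) ^ b * ‖x - y‖ ≤ K * δ ^ b * ‖x - y‖ := by gcongr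
  have e5 : C * (n * h) ^ a * ‖x - y‖ ≤ C * δ ^ a * ‖x - y‖ := by gcongr
  have : eulerFlow g h i n x - eulerFlow g h i n y = (x - y) +
      (g ((i + n : ℕ) * h) (i * h) x - g ((i + n : ℕ) * h) (i * h) y) +
      ((eulerFlow g h i n x - (x + g ((i + n : ℕ) * h) (i * h) x)) -
        (eulerFlow g h i n y - (y + g ((i + n : ℕ) * h) (i * h) y))) := by abel
  rw [this]
  refine norm_add₃_le.trans ?_
  linarith

theorem eulerFlow_lipschitz_of_blocks {h L T : ℝ} (hh : 0 ≤ h) (hL : 1 ≤ L) {q : ℕ}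
    (hq : ∀ n i : ℕ, n ≤ q → (i + n : ℕ) * h ≤ T → ∀ x y : E,
      ‖eulerFlow g h i n x - eulerFlow g h i n y‖ ≤ L * ‖x - y‖) (k : ℕ) :
    ∀ n i : ℕ, n ≤ k * q → (i + n : ℕ) * h ≤ T → ∀ x y : E,
      ‖eulerFlow g h i n x - eulerFlow g h i n y‖ ≤ L ^ k * ‖x - y‖ := by
  induction k with
  | zero =>
    intro n i hn _ x y
    obtain rfl : n = 0 := by simpa using hn
    simp [eulerFlow]
  | succ k ih =>
    intro n i hn hi x y
    obtain ⟨m, r, rfl, hm, hr⟩ : ∃ m r, n = m + r ∧ m ≤ k * q ∧ r ≤ q :=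
      ⟨min n (k * q), n - min n (k * q), by omega, min_le_right _ _, by
        rw [add_mul, one_mul] at hn; omega⟩
    rw [eulerFlow_add, eulerFlow_add]
    have hm' : ((i + m : ℕ) : ℝ) * h ≤ T :=
      le_trans (mul_le_mul_of_nonneg_right (by exact_mod_cast (by omega)) hh) hi
    calc _ ≤ L * ‖eulerFlow g h i m x - eulerFlow g h i m y‖ :=
          hq r (i + m) hr (by rw [add_assoc]; exact hi) _ _
      _ ≤ L * (L ^ k * ‖x - y‖) := by gcongr; exact ih m i hm hm' x y
      _ = L ^ (k + 1) * ‖x - y‖ := by ring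

theorem exists_closing_constants (hK : 0 ≤ K) (hb : 0 < b) (ha : 1 < a) :
    ∃ C : ℝ, 0 ≤ C ∧ ∀ᶠ δ : ℝ in nhds 0, K * δ ^ b ≤ 1 ∧
      (2 / 3 : ℝ) ^ (a - 1) * (1 + 3 * (K * δ ^ b) + C * δ ^ a) * C + K ≤ C := by
  set θ := (2 / 3 : ℝ) ^ (a - 1) with hθ
  have hθ1 : θ < 1 := Real.rpow_lt_one (by norm_num) (by norm_num) (by linarith)
  have h1θ : 0 < 1 - θ := by linarith
  refine ⟨(K + 1) / (1 - θ), by positivity, ?_⟩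
  set C := (K + 1) / (1 - θ) with hCdef
  have hC : C * (1 - θ) = K + 1 := by rw [hCdef]; field_simp
  have cb : ContinuousAt (fun δ : ℝ => δ ^ b) 0 := Real.continuousAt_rpow_const _ _ (Or.inr hb.le)
  have ca : ContinuousAt (fun δ : ℝ => δ ^ a) 0 :=
    Real.continuousAt_rpow_const _ _ (Or.inr (by linarith))
  have c1 : ContinuousAt (fun δ : ℝ => K * δ ^ b) 0 := continuousAt_const.mul cb
  have c2 : ContinuousAt
      (fun δ : ℝ => θ * (1 + 3 * (K * δ ^ b) + C * δ ^ a) * C + K) 0 := by fun_prop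
  refine ((c1.eventually_lt (g := fun _ => 1) continuousAt_const ?_).and
    (c2.eventually_lt (g := fun _ => C) continuousAt_const ?_)).mono
      fun δ hδ => ⟨hδ.1.le, hδ.2.le⟩
  · simp [Real.zero_rpow hb.ne']
  · simp only [Real.zero_rpow hb.ne', Real.zero_rpow (show a ≠ 0 by linarith)]
    linarith

/-- Uniform local accuracy and Lipschitz stability of the dyadic schemes. -/
theorem exists_uniform_estimates (hg : AlmostFlow T K b a g) (hT : 0 < T) (hb : 0 < b)
    (ha : 1 < a) :
    ∃ C L δ : ℝ, 0 ≤ C ∧ 0 ≤ L ∧ 0 < δ ∧ ∃ N : ℕ, ∀ n ≥ N,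
      (∀ m i : ℕ, m * (T / 2 ^ n) ≤ δ → (i + m : ℕ) * (T / 2 ^ n) ≤ T → ∀ x,
        ‖eulerFlow g (T / 2 ^ n) i m x -
          (x + g ((i + m : ℕ) * (T / 2 ^ n)) (i * (T / 2 ^ n)) x)‖ ≤
            C * (m * (T / 2 ^ n)) ^ a) ∧
      ∀ m i : ℕ, (i + m : ℕ) * (T / 2 ^ n) ≤ T → ∀ x y,
        ‖eulerFlow g (T / 2 ^ n) i m x - eulerFlow g (T / 2 ^ n) i m y‖ ≤ L * ‖x - y‖ := by
  have hK := hg.K_nonneg hT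
  obtain ⟨C, hC, hev⟩ := exists_closing_constants hK hb ha
  have htend : Filter.Tendsto (fun n : ℕ => T / 2 ^ n) Filter.atTop (nhds 0) := by
    have := (tendsto_pow_atTop_nhds_zero_of_lt_one (r := (1 / 2 : ℝ)) (by norm_num)
      (by norm_num)).const_mul T
    simpa [div_eq_mul_inv] using this
  obtain ⟨N, hsmall, hclose⟩ := (htend.eventually hev).exists
  set δ := T / 2 ^ N with hδ
  have hδ0 : 0 < δ := by positivity
  have hL : 1 ≤ 1 + K * δ ^ b + C * δ ^ a := by
    have : 0 ≤ K * δ ^ b := by positivity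
    have : 0 ≤ C * δ ^ a := by positivity
    linarith
  refine ⟨C, (1 + K * δ ^ b + C * δ ^ a) ^ (2 ^ N), δ, hC, by positivity, hδ0, N,
    fun n hn => ⟨fun m i hm hi x => ?_, fun m i hi x y => ?_⟩⟩
  · exact (hg.eulerFlow_sub_bddLip hK hb ha hC hδ0.le hsmall hclose (by positivity) m i hm hi).1 x
  · have hh : 0 < T / 2 ^ n := by positivity
    have hpow : (2 : ℝ) ^ n = 2 ^ N * 2 ^ (n - N) := by rw [← pow_add]; congr 1; omega
    refine eulerFlow_lipschitz_of_blocks hh.le hL (q := 2 ^ (n - N)) (T := T)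
      (fun r j hr hj x y => hg.eulerFlow_lipschitz_of_le hK hb ha hC hδ0.le hsmall hclose hh.le
        ?_ hj x y) (2 ^ N) m i ?_ hi x y
    · have hr' : (r : ℝ) ≤ 2 ^ (n - N) := by exact_mod_cast hr
      calc r * (T / 2 ^ n) ≤ 2 ^ (n - N) * (T / 2 ^ n) := by gcongr
        _ = δ := by rw [hδ, hpow]; field_simp
    · rw [← pow_add, Nat.add_sub_cancel' hn]
      have h1 : ((i + m : ℕ) : ℝ) ≤ 2 ^ n := by
        rw [mul_div_assoc', div_le_iff₀ (by positivity), mul_comm] at hi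
        exact le_of_mul_le_mul_left hi hT
      have h2 : i + m ≤ 2 ^ n := by exact_mod_cast h1
      omega

end AlmostFlow

end AlmostFlow

section Limit

variable {E : Type*} [NormedAddCommGroup E] [NormedSpace ℝ E]

open Filter Topology

/-- `z` follows the one-step maps `x ↦ x + g t s x` on `[0, T]` up to errors of order `a`. -/
def FollowsSteps (T C δ a : ℝ) (g : ℝ → ℝ → E → E) (z : ℝ → E) : Prop :=
  ∀ s t : ℝ, 0 ≤ s → s ≤ t → t ≤ T → t - s ≤ δ →
    ‖z t - (z s + g t s (z s))‖ ≤ C * (t - s) ^ a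

theorem norm_sub_eulerFlow_le {g : ℝ → ℝ → E → E} {h L e T : ℝ} (hL0 : 0 ≤ L)
    (hL : ∀ m i : ℕ, (i + m : ℕ) * h ≤ T → ∀ x y,
      ‖eulerFlow g h i m x - eulerFlow g h i m y‖ ≤ L * ‖x - y‖)
    (y : ℕ → E) {m : ℕ} (hm : m * h ≤ T)
    (hy : ∀ i < m, ‖y (i + 1) - (y i + g ((i + 1 : ℕ) * h) (i * h) (y i))‖ ≤ e) :
    ‖y m - eulerFlow g h 0 m (y 0)‖ ≤ m * (L * e) := by
  have key : ∀ k ≤ m, ‖eulerFlow g h k (m - k) (y k) - eulerFlow g h 0 m (y 0)‖ ≤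
      k * (L * e) := by
    intro k
    induction k with
    | zero => simp
    | succ k ih =>
      intro hk
      have h1 := ih (by omega)
      have h2 : eulerFlow g h k (m - k) (y k) = eulerFlow g h (k + 1) (m - (k + 1))
          (y k + g ((k + 1 : ℕ) * h) (k * h) (y k)) := by
        rw [show m - k = 1 + (m - (k + 1)) by omega, eulerFlow_add]
        simp [eulerFlow]
      have h3 := hL (m - (k + 1)) (k + 1)
        (by rw [Nat.add_sub_cancel' hk]; exact hm) (y (k + 1))
        (y k + g ((k + 1 : ℕ) * h) (k * h) (y k))
      rw [← h2] at h3
      have h4 := mul_le_mul_of_nonneg_left (hy k (by omega)) hL0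
      have h5 := norm_sub_le_norm_sub_add_norm_sub (eulerFlow g h (k + 1) (m - (k + 1)) (y (k + 1)))
        (eulerFlow g h k (m - k) (y k)) (eulerFlow g h 0 m (y 0))
      push_cast
      linarith
  simpa [eulerFlow] using key m le_rfl

theorem rpow_dyadic (T : ℝ) (hT : 0 < T) (c : ℝ) (n : ℕ) :
    (T / 2 ^ n) ^ c = T ^ c * ((1 / 2 : ℝ) ^ c) ^ n := by
  rw [Real.div_rpow hT.le (by positivity), Real.div_rpow (by norm_num) (by norm_num),
    Real.one_rpow, ← Real.rpow_natCast, ← Real.rpow_mul (by norm_num), div_pow, one_pow,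
    ← Real.rpow_natCast (2 ^ c), ← Real.rpow_mul (by norm_num), mul_comm (n : ℝ) c]
  ring

theorem tendsto_dyadic (T : ℝ) : Tendsto (fun n : ℕ => T / 2 ^ n) atTop (𝓝 0) := by
  have := (tendsto_pow_atTop_nhds_zero_of_lt_one (r := (1 / 2 : ℝ)) (by norm_num)
    (by norm_num)).const_mul T
  simpa [div_eq_mul_inv] using this

namespace AlmostFlow

variable {T K b a : ℝ} {g : ℝ → ℝ → E → E}

theorem norm_le (hg : AlmostFlow T K b a g) {s t : ℝ} (hs : 0 ≤ s) (hst : s ≤ t) (ht : t ≤ T)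
    (x : E) : ‖g t s x‖ ≤ K * (t - s) ^ b :=
  (hg.bddC11 s t hs hst ht).1.1 x

theorem norm_eulerFlow_refine_le (hg : AlmostFlow T K b a g) (hT : 0 < T)
    {h L : ℝ} (hh : 0 < h) (hL0 : 0 ≤ L)
    (hL : ∀ m i : ℕ, (i + m : ℕ) * h ≤ T → ∀ x y,
      ‖eulerFlow g h i m x - eulerFlow g h i m y‖ ≤ L * ‖x - y‖) {m : ℕ} (hm : m * h ≤ T)
    (x : E) : ‖eulerFlow g (h / 2) 0 (2 * m) x - eulerFlow g h 0 m x‖ ≤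
      T * L * K * h ^ (a - 1) := by
  have hK := hg.K_nonneg hT
  have h1 := norm_sub_eulerFlow_le (e := K * h ^ a) hL0 hL
    (fun i => eulerFlow g (h / 2) 0 (2 * i) x) hm ?_
  · refine h1.trans ?_
    have : h ^ a = h * h ^ (a - 1) := by
      rw [mul_comm, ← Real.rpow_add_one hh.ne', sub_add_cancel]
    calc (m : ℝ) * (L * (K * h ^ a)) = (m * h) * (L * K * h ^ (a - 1)) := by rw [this]; ring
      _ ≤ T * (L * K * h ^ (a - 1)) := by gcongr
      _ = _ := by ring
  · intro i hi
    have him : ((i + 1 : ℕ) : ℝ) * h ≤ T :=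
      le_trans (mul_le_mul_of_nonneg_right (by exact_mod_cast hi) hh.le) hm
    have e0 : ((2 * i : ℕ) : ℝ) * (h / 2) = i * h := by push_cast; ring
    have e2 : ((2 * i + 1 + 1 : ℕ) : ℝ) * (h / 2) = (i + 1 : ℕ) * h := by push_cast; ring
    have d := (hg.defect (i * h) ((2 * i + 1 : ℕ) * (h / 2)) ((i + 1 : ℕ) * h)
      (by positivity) (by push_cast; linarith) (by push_cast; linarith) him).1
      (eulerFlow g (h / 2) 0 (2 * i) x)
    have e3 : ((i + 1 : ℕ) * h - i * h : ℝ) = h := by push_cast; ring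
    rw [e3] at d
    convert d using 2
    change eulerFlow g (h / 2) 0 (2 * i + 2) x - _ = _
    rw [eulerFlow_add]
    simp only [eulerFlow, zero_add, add_zero, e0, e2]
    abel

theorem norm_eulerFlow_succ_sub_le (hg : AlmostFlow T K b a g) {h : ℝ} (hh : 0 ≤ h) {m : ℕ}
    (hm : (m + 1 : ℕ) * h ≤ T) (x : E) :
    ‖eulerFlow g h 0 (m + 1) x - eulerFlow g h 0 m x‖ ≤ K * h ^ b := by
  have := hg.norm_le (s := m * h) (t := (m + 1 : ℕ) * h) (by positivity)
    (by push_cast; nlinarith) hm (eulerFlow g h 0 m x)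
  rw [show ((m + 1 : ℕ) * h - m * h : ℝ) = h by push_cast; ring] at this
  simpa [eulerFlow] using this

theorem exists_limit [CompleteSpace E] (hg : AlmostFlow T K b a g) (hT : 0 < T) (hb : 0 < b)
    (ha : 1 < a) {L : ℝ} (hL0 : 0 ≤ L) {N : ℕ}
    (hL : ∀ n ≥ N, ∀ m i : ℕ, (i + m : ℕ) * (T / 2 ^ n) ≤ T → ∀ x y,
      ‖eulerFlow g (T / 2 ^ n) i m x - eulerFlow g (T / 2 ^ n) i m y‖ ≤ L * ‖x - y‖)
    (x : E) {t : ℝ} (ht0 : 0 ≤ t) (htT : t ≤ T) :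
    ∃ z, Tendsto (fun n => eulerFlow g (T / 2 ^ n) 0 ⌊t / (T / 2 ^ n)⌋₊ x) atTop (𝓝 z) := by
  have hK := hg.K_nonneg hT
  set Z : ℕ → E := fun n => eulerFlow g (T / 2 ^ n) 0 ⌊t / (T / 2 ^ n)⌋₊ x with hZ
  set α : ℝ := (1 / 2 : ℝ) ^ (a - 1)
  set β : ℝ := (1 / 2 : ℝ) ^ b
  have hα0 : 0 ≤ α := by positivity
  have hβ0 : 0 ≤ β := by positivity
  have hα : α < 1 := Real.rpow_lt_one (by norm_num) (by norm_num) (by linarith)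
  have hβ : β < 1 := Real.rpow_lt_one (by norm_num) (by norm_num) hb
  have hstep : ∀ n ≥ N, ‖Z (n + 1) - Z n‖ ≤
      T * L * K * T ^ (a - 1) * α ^ n + K * T ^ b * β ^ (n + 1) := by
    intro n hn
    have hh : 0 < T / 2 ^ n := by positivity
    have hhalf : T / 2 ^ (n + 1) = T / 2 ^ n / 2 := by rw [pow_succ]; field_simp
    have hfl : (⌊t / (T / 2 ^ n)⌋₊ : ℝ) * (T / 2 ^ n) ≤ t :=
      (le_div_iff₀ hh).1 (Nat.floor_le (by positivity))
    have h1 := hg.norm_eulerFlow_refine_le hT hh hL0 (hL n hn) (hfl.trans htT) x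
    rw [← hhalf, rpow_dyadic T hT] at h1
    have hh' : 0 < T / 2 ^ (n + 1) := by positivity
    have hfl' : (⌊t / (T / 2 ^ (n + 1))⌋₊ : ℝ) * (T / 2 ^ (n + 1)) ≤ t :=
      (le_div_iff₀ hh').1 (Nat.floor_le (by positivity))
    have hdouble : t / (T / 2 ^ (n + 1)) = 2 * (t / (T / 2 ^ n)) := by rw [hhalf]; field_simp
    have hcase : ⌊t / (T / 2 ^ (n + 1))⌋₊ = 2 * ⌊t / (T / 2 ^ n)⌋₊ ∨
        ⌊t / (T / 2 ^ (n + 1))⌋₊ = 2 * ⌊t / (T / 2 ^ n)⌋₊ + 1 := by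
      rw [hdouble]
      have hw : 0 ≤ t / (T / 2 ^ n) := by positivity
      have a1 := Nat.floor_le hw
      have a2 := Nat.lt_floor_add_one (t / (T / 2 ^ n))
      have b1 : 2 * ⌊t / (T / 2 ^ n)⌋₊ ≤ ⌊2 * (t / (T / 2 ^ n))⌋₊ :=
        Nat.le_floor (by push_cast; linarith)
      have b2 : ⌊2 * (t / (T / 2 ^ n))⌋₊ < 2 * ⌊t / (T / 2 ^ n)⌋₊ + 2 :=
        (Nat.floor_lt (by positivity)).2 (by push_cast; linarith)
      omega
    have hKβ : 0 ≤ K * T ^ b * β ^ (n + 1) := by positivity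
    rcases hcase with hc | hc
    · simp only [hZ, hc]
      linarith
    · have h2 := hg.norm_eulerFlow_succ_sub_le hh'.le (m := 2 * ⌊t / (T / 2 ^ n)⌋₊)
        (by rw [← hc]; exact hfl'.trans htT) x
      rw [rpow_dyadic T hT, ← mul_assoc] at h2
      simp only [hZ, hc]
      have h3 := norm_sub_le_norm_sub_add_norm_sub
        (eulerFlow g (T / 2 ^ (n + 1)) 0 (2 * ⌊t / (T / 2 ^ n)⌋₊ + 1) x)
        (eulerFlow g (T / 2 ^ (n + 1)) 0 (2 * ⌊t / (T / 2 ^ n)⌋₊) x)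
        (eulerFlow g (T / 2 ^ n) 0 ⌊t / (T / 2 ^ n)⌋₊ x)
      linarith
  have hsum : Summable fun n : ℕ =>
      T * L * K * T ^ (a - 1) * α ^ n + K * T ^ b * β ^ (n + 1) :=
    ((summable_geometric_of_lt_one hα0 hα).mul_left _).add
      (((summable_nat_add_iff 1).2 (summable_geometric_of_lt_one hβ0 hβ)).mul_left _)
  have hcau : CauchySeq fun n => Z (n + N) := by
    refine cauchySeq_of_dist_le_of_summable _ (fun n => ?_) ((summable_nat_add_iff N).2 hsum)
    rw [dist_comm, dist_eq_norm]
    rw [show n.succ + N = n + N + 1 by omega]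
    exact hstep (n + N) (by omega)
  obtain ⟨z, hz⟩ := cauchySeq_tendsto_of_complete hcau
  exact ⟨z, (tendsto_add_atTop_iff_nat N).1 hz⟩

theorem tendsto_dyadic_floor (hT : 0 < T) {t : ℝ} (ht0 : 0 ≤ t) :
    Tendsto (fun n : ℕ => (⌊t / (T / 2 ^ n)⌋₊ : ℝ) * (T / 2 ^ n)) atTop (𝓝 t) := by
  refine tendsto_of_tendsto_of_tendsto_of_le_of_le
    (g := fun n : ℕ => t - T / 2 ^ n) (h := fun _ => t) ?_ tendsto_const_nhds ?_ ?_
  · simpa using tendsto_const_nhds.sub (tendsto_dyadic T)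
  · intro n
    have hh : 0 < T / 2 ^ n := by positivity
    have := (div_lt_iff₀ hh).1 (Nat.lt_floor_add_one (t / (T / 2 ^ n)))
    simp only
    linarith
  · intro n
    have hh : 0 < T / 2 ^ n := by positivity
    exact (le_div_iff₀ hh).1 (Nat.floor_le (by positivity))

theorem tendsto_eulerFlow_of_followsSteps (hg : AlmostFlow T K b a g) (hT : 0 < T) (hb : 0 < b)
    {L : ℝ} (hL0 : 0 ≤ L) {N : ℕ}
    (hL : ∀ n ≥ N, ∀ m i : ℕ, (i + m : ℕ) * (T / 2 ^ n) ≤ T → ∀ x y,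
      ‖eulerFlow g (T / 2 ^ n) i m x - eulerFlow g (T / 2 ^ n) i m y‖ ≤ L * ‖x - y‖)
    {C δ c : ℝ} (hC : 0 ≤ C) (hδ : 0 < δ) (hc : 1 < c) {z : ℝ → E}
    (hz : FollowsSteps T C δ c g z) {t : ℝ} (ht0 : 0 ≤ t) (htT : t ≤ T) :
    Tendsto (fun n => eulerFlow g (T / 2 ^ n) 0 ⌊t / (T / 2 ^ n)⌋₊ (z 0)) atTop (𝓝 (z t)) := by
  have htn := tendsto_dyadic_floor hT ht0
  have hfl : ∀ n : ℕ, (⌊t / (T / 2 ^ n)⌋₊ : ℝ) * (T / 2 ^ n) ≤ t := fun n =>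
    (le_div_iff₀ (by positivity : 0 < T / 2 ^ n)).1 (Nat.floor_le (by positivity))
  rw [tendsto_iff_norm_sub_tendsto_zero]
  have hev : ∀ᶠ n : ℕ in atTop, N ≤ n ∧ T / 2 ^ n ≤ δ ∧
      t - (⌊t / (T / 2 ^ n)⌋₊ : ℝ) * (T / 2 ^ n) ≤ δ := by
    refine (eventually_ge_atTop N).and (((tendsto_dyadic T).eventually_le_const hδ).and ?_)
    have := (tendsto_const_nhds (x := t)).sub htn
    rw [sub_self] at this
    exact this.eventually_le_const hδ
  refine squeeze_zero' (g := fun n : ℕ => T * L * C * (T / 2 ^ n) ^ (c - 1) +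
    (C * (t - (⌊t / (T / 2 ^ n)⌋₊ : ℝ) * (T / 2 ^ n)) ^ c +
      K * (t - (⌊t / (T / 2 ^ n)⌋₊ : ℝ) * (T / 2 ^ n)) ^ b))
    (Eventually.of_forall fun _ => norm_nonneg _) ?_ ?_
  · filter_upwards [hev] with n hn
    obtain ⟨hn1, hn2, hn3⟩ := hn
    have hh : 0 < T / 2 ^ n := by positivity
    set τ := (⌊t / (T / 2 ^ n)⌋₊ : ℝ) * (T / 2 ^ n) with hτ
    have hτ0 : 0 ≤ τ := by positivity
    have h1 := norm_sub_eulerFlow_le (e := C * (T / 2 ^ n) ^ c) hL0 (hL n hn1)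
      (fun i => z (i * (T / 2 ^ n))) ((hfl n).trans htT) (fun i hi => by
        have hle : ((i + 1 : ℕ) : ℝ) * (T / 2 ^ n) ≤ T :=
          le_trans (mul_le_mul_of_nonneg_right (by exact_mod_cast hi) hh.le) ((hfl n).trans htT)
        have e : ((i + 1 : ℕ) * (T / 2 ^ n) - i * (T / 2 ^ n) : ℝ) = T / 2 ^ n := by
          push_cast; ring
        have := hz (i * (T / 2 ^ n)) ((i + 1 : ℕ) * (T / 2 ^ n)) (by positivity)
          (by linarith) hle (by linarith)
        rwa [e] at this)
    have h2 : (⌊t / (T / 2 ^ n)⌋₊ : ℝ) * (L * (C * (T / 2 ^ n) ^ c)) ≤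
        T * L * C * (T / 2 ^ n) ^ (c - 1) := by
      have : (T / 2 ^ n) ^ c = (T / 2 ^ n) * (T / 2 ^ n) ^ (c - 1) := by
        rw [mul_comm, ← Real.rpow_add_one hh.ne', sub_add_cancel]
      calc (⌊t / (T / 2 ^ n)⌋₊ : ℝ) * (L * (C * (T / 2 ^ n) ^ c))
          = τ * (L * C * (T / 2 ^ n) ^ (c - 1)) := by rw [this, hτ]; ring
        _ ≤ T * (L * C * (T / 2 ^ n) ^ (c - 1)) := by
            gcongr
            exact (hfl n).trans htT
        _ = _ := by ring
    have h3 := hz τ t hτ0 (hfl n) htT hn3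
    have h4 := hg.norm_le hτ0 (hfl n) htT (z τ)
    have h5 : ‖z t - z τ‖ ≤ C * (t - τ) ^ c + K * (t - τ) ^ b := by
      have : z t - z τ = (z t - (z τ + g t τ (z τ))) + g t τ (z τ) := by abel
      rw [this]
      exact (norm_add_le _ _).trans (add_le_add h3 h4)
    simp only [Nat.cast_zero, zero_mul] at h1
    rw [← hτ] at h1
    have h6 := norm_sub_le_norm_sub_add_norm_sub
      (eulerFlow g (T / 2 ^ n) 0 ⌊t / (T / 2 ^ n)⌋₊ (z 0)) (z τ) (z t)
    rw [norm_sub_rev _ (z τ), norm_sub_rev (z τ) (z t)] at h6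
    linarith
  · have hzero : ∀ {u : ℕ → ℝ} {r : ℝ}, 0 < r → Tendsto u atTop (𝓝 0) →
        Tendsto (fun n => u n ^ r) atTop (𝓝 0) := by
      intro u r hr hu
      simpa [Real.zero_rpow hr.ne'] using hu.rpow_const (Or.inr hr.le)
    have hd : Tendsto (fun n : ℕ => t - (⌊t / (T / 2 ^ n)⌋₊ : ℝ) * (T / 2 ^ n)) atTop (𝓝 0) := by
      simpa using (tendsto_const_nhds (x := t)).sub htn
    simpa using ((hzero (by linarith : 0 < c - 1) (tendsto_dyadic T)).const_mul (T * L * C)).add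
      (((hzero (by linarith : 0 < c) hd).const_mul C).add ((hzero hb hd).const_mul K))

/-- An almost flow has exactly one path starting from `x₀` that follows its steps. -/
theorem exists_unique_followsSteps [CompleteSpace E] (hg : AlmostFlow T K b a g) (hT : 0 < T)
    (hb : 0 < b) (ha : 1 < a)
    (hcont : ∀ x, ContinuousOn (fun q : ℝ × ℝ => g q.2 q.1 x)
      {q : ℝ × ℝ | 0 ≤ q.1 ∧ q.1 ≤ q.2 ∧ q.2 ≤ T}) (x₀ : E) :
    ∃ z : ℝ → E, z 0 = x₀ ∧ (∃ C δ : ℝ, 0 ≤ C ∧ 0 < δ ∧ FollowsSteps T C δ a g z) ∧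
      ∀ z' : ℝ → E, z' 0 = x₀ →
        (∃ c C δ : ℝ, 1 < c ∧ 0 ≤ C ∧ 0 < δ ∧ FollowsSteps T C δ c g z') →
          ∀ t : ℝ, 0 ≤ t → t ≤ T → z' t = z t := by
  have hK := hg.K_nonneg hT
  obtain ⟨C, L, δ, hC, hL0, hδ, N, hN⟩ := hg.exists_uniform_estimates hT hb ha
  have hL := fun n hn => (hN n hn).2
  choose! z hz using fun (t : ℝ) (ht : 0 ≤ t ∧ t ≤ T) =>
    hg.exists_limit hT hb ha hL0 hL x₀ ht.1 ht.2
  refine ⟨z, ?_, ⟨C, δ / 2, hC, by positivity, ?_⟩, ?_⟩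
  · have := hz 0 ⟨le_rfl, hT.le⟩
    simp only [zero_div, Nat.floor_zero, eulerFlow] at this
    exact tendsto_nhds_unique this tendsto_const_nhds
  · intro s t hs hst ht hδ'
    have hs' : s ≤ T := hst.trans ht
    have ht' : 0 ≤ t := hs.trans hst
    set S : ℕ → ℝ := fun n => (⌊s / (T / 2 ^ n)⌋₊ : ℝ) * (T / 2 ^ n) with hS
    set U : ℕ → ℝ := fun n => (⌊t / (T / 2 ^ n)⌋₊ : ℝ) * (T / 2 ^ n) with hU
    have hSt : Tendsto S atTop (𝓝 s) := tendsto_dyadic_floor hT hs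
    have hUt : Tendsto U atTop (𝓝 t) := tendsto_dyadic_floor hT ht'
    have hS0 : ∀ n, 0 ≤ S n := fun n => by positivity
    have hUT : ∀ n, U n ≤ T := fun n =>
      ((le_div_iff₀ (by positivity : 0 < T / 2 ^ n)).1 (Nat.floor_le (by positivity))).trans ht
    have hfloor : ∀ n : ℕ, ⌊s / (T / 2 ^ n)⌋₊ ≤ ⌊t / (T / 2 ^ n)⌋₊ := fun n => by gcongr
    have hSU : ∀ n, S n ≤ U n := fun n =>
      mul_le_mul_of_nonneg_right (by exact_mod_cast hfloor n) (by positivity)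
    set Zs : ℕ → E := fun n => eulerFlow g (T / 2 ^ n) 0 ⌊s / (T / 2 ^ n)⌋₊ x₀ with hZs
    have hgt : Tendsto (fun n => g (U n) (S n) (Zs n)) atTop (𝓝 (g t s (z s))) := by
      have h1 : Tendsto (fun n => g (U n) (S n) (z s)) atTop (𝓝 (g t s (z s))) :=
        (hcont (z s) (s, t) ⟨hs, hst, ht⟩).tendsto.comp
          (tendsto_nhdsWithin_iff.2 ⟨hSt.prodMk_nhds hUt,
            Eventually.of_forall fun n => ⟨hS0 n, hSU n, hUT n⟩⟩)
      have h2 : Tendsto (fun n => g (U n) (S n) (Zs n) - g (U n) (S n) (z s)) atTop (𝓝 0) := by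
        refine squeeze_zero_norm (a := fun n => K * T ^ b * ‖Zs n - z s‖) (fun n => ?_) ?_
        · refine ((hg.bddC11 _ _ (hS0 n) (hSU n) (hUT n)).1.2 _ _).trans ?_
          have e1 := hSU n
          have e2 := hUT n
          have e3 := hS0 n
          gcongr
          linarith
        · simpa using (tendsto_iff_norm_sub_tendsto_zero.1 (hz s ⟨hs, hs'⟩)).const_mul (K * T ^ b)
      simpa using h2.add h1
    have hlhs := ((hz t ⟨ht', ht⟩).sub ((hz s ⟨hs, hs'⟩).add hgt)).norm
    have hrhs : Tendsto (fun n => C * (U n - S n) ^ a) atTop (𝓝 (C * (t - s) ^ a)) :=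
      ((hUt.sub hSt).rpow_const (Or.inr (by linarith))).const_mul C
    refine le_of_tendsto_of_tendsto hlhs hrhs ?_
    filter_upwards [eventually_ge_atTop N,
      (hUt.sub hSt).eventually_le_const (show t - s < δ by linarith)] with n hn hn2
    have e := (hN n hn).1 (⌊t / (T / 2 ^ n)⌋₊ - ⌊s / (T / 2 ^ n)⌋₊) ⌊s / (T / 2 ^ n)⌋₊
    rw [Nat.add_sub_cancel' (hfloor n), Nat.cast_sub (hfloor n), sub_mul] at e
    have e' := e hn2 (hUT n) (Zs n)
    have hZt : eulerFlow g (T / 2 ^ n) ⌊s / (T / 2 ^ n)⌋₊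
        (⌊t / (T / 2 ^ n)⌋₊ - ⌊s / (T / 2 ^ n)⌋₊) (Zs n) =
          eulerFlow g (T / 2 ^ n) 0 ⌊t / (T / 2 ^ n)⌋₊ x₀ := by
      have := eulerFlow_add g (T / 2 ^ n) 0 ⌊s / (T / 2 ^ n)⌋₊
        (⌊t / (T / 2 ^ n)⌋₊ - ⌊s / (T / 2 ^ n)⌋₊) x₀
      rw [Nat.add_sub_cancel' (hfloor n), zero_add] at this
      exact this.symm
    rw [hZt] at e'
    exact e'
  · rintro z' rfl ⟨c, C', δ', hc, hC', hδ', hz'⟩ t ht0 htT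
    exact tendsto_nhds_unique
      (hg.tendsto_eulerFlow_of_followsSteps hT hb hL0 hL hC' hδ' hc hz' ht0 htT)
      (hz t ⟨ht0, htT⟩)

end AlmostFlow

end Limit

section RoughStep

variable {E : Type*} [NormedAddCommGroup E] [NormedSpace ℝ E] {ι : Type*} [Fintype ι]

/-- The vector field `DV_k (V_j)`, indexed by `(j, k)`. -/
def iteratedField (Vf : ι → E → E) (q : ι × ι) : E → E :=
  fun x => fderiv ℝ (Vf q.2) x (Vf q.1 x)

/-- The increment of the second-order Taylor scheme
`y ↦ Δ V(y) + X^i V_i(y) + 𝕏^{jk} DV_k(y) V_j(y)`. -/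
def roughStep (V : E → E) (Vf : ι → E → E) (Δ : ℝ) (X : ι → ℝ) (XX : ι × ι → ℝ) : E → E :=
  fun y => (∑ i, X i • Vf i y) + (Δ • V y + ∑ q, XX q • iteratedField Vf q y)

variable {V : E → E} {Vf : ι → E → E} {A B ε M : ℝ}

theorem roughStep_rest_bddLip (hV : BddC11 B V)
    (hW : ∀ q, BddC11 B (iteratedField Vf q)) {Δ : ℝ} {XX : ι × ι → ℝ}
    (hΔ : |Δ| ≤ A * ε ^ 2) (hXX : ∑ q, |XX q| ≤ A * ε ^ 2) :
    BddC11 (2 * A * B * ε ^ 2) (fun y => Δ • V y + ∑ q, XX q • iteratedField Vf q y) := by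
  have hB := hV.1.nonneg
  refine ((hV.smul Δ).add (BddC11.sum_smul Finset.univ XX hW)).mono ?_
  nlinarith [mul_le_mul_of_nonneg_right hΔ hB, mul_le_mul_of_nonneg_right hXX hB]

theorem roughStep_bddC11 (hV : BddC11 B V) (hVf : ∀ i, BddC11 B (Vf i))
    (hW : ∀ q, BddC11 B (iteratedField Vf q)) (hA : 0 ≤ A) (hε : 0 ≤ ε) (hεM : ε ≤ M)
    {Δ : ℝ} {X : ι → ℝ} {XX : ι × ι → ℝ}
    (hΔ : |Δ| ≤ A * ε ^ 2) (hX : ∑ i, |X i| ≤ A * ε) (hXX : ∑ q, |XX q| ≤ A * ε ^ 2) :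
    BddC11 (A * B * (1 + 2 * M) * ε) (roughStep V Vf Δ X XX) := by
  have hB := hV.1.nonneg
  refine ((BddC11.sum_smul Finset.univ X hVf).add
    (roughStep_rest_bddLip hV hW hΔ hXX)).mono ?_
  have h1 := mul_le_mul_of_nonneg_right hX hB
  have h2 := mul_le_mul_of_nonneg_left hεM (mul_nonneg (mul_nonneg hA hB) hε)
  nlinarith

theorem roughStep_defect_eq (V : E → E) (Vf : ι → E → E) (Δ₁ Δ₂ : ℝ) (X₁ X₂ : ι → ℝ)
    (XX₁ XX₂ : ι × ι → ℝ) (x : E) :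
    roughStep V Vf Δ₁ X₁ XX₁ x + roughStep V Vf Δ₂ X₂ XX₂ (x + roughStep V Vf Δ₁ X₁ XX₁ x) -
      roughStep V Vf (Δ₁ + Δ₂) (fun i => X₁ i + X₂ i)
        (fun q => XX₁ q + XX₂ q + X₁ q.1 * X₂ q.2) x =
    (∑ k, X₂ k • taylorRem (Vf k) x (roughStep V Vf Δ₁ X₁ XX₁ x)) +
      (∑ k, X₂ k • fderiv ℝ (Vf k) x
        (Δ₁ • V x + ∑ q, XX₁ q • iteratedField Vf q x)) +
      (Δ₂ • (V (x + roughStep V Vf Δ₁ X₁ XX₁ x) - V x)) +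
      ∑ q, XX₂ q • (iteratedField Vf q (x + roughStep V Vf Δ₁ X₁ XX₁ x) -
        iteratedField Vf q x) := by
  set y := roughStep V Vf Δ₁ X₁ XX₁ x with hy
  set R := Δ₁ • V x + ∑ q, XX₁ q • iteratedField Vf q x with hR
  have hyR : y = (∑ i, X₁ i • Vf i x) + R := rfl
  have hcross : ∑ q : ι × ι, (X₁ q.1 * X₂ q.2) • iteratedField Vf q x =
      ∑ k, X₂ k • fderiv ℝ (Vf k) x (∑ i, X₁ i • Vf i x) := by
    rw [Fintype.sum_prod_type_right]
    refine Finset.sum_congr rfl fun k _ => ?_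
    rw [map_sum, Finset.smul_sum]
    refine Finset.sum_congr rfl fun j _ => ?_
    rw [map_smul, smul_smul, mul_comm]
    rfl
  have htaylor : (∑ k, X₂ k • taylorRem (Vf k) x y) + (∑ k, X₂ k • fderiv ℝ (Vf k) x R) =
      (∑ k, X₂ k • Vf k (x + y)) - (∑ k, X₂ k • Vf k x) -
        ∑ k, X₂ k • fderiv ℝ (Vf k) x (∑ i, X₁ i • Vf i x) := by
    rw [← Finset.sum_add_distrib, ← Finset.sum_sub_distrib, ← Finset.sum_sub_distrib]
    refine Finset.sum_congr rfl fun k _ => ?_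
    rw [← smul_add, ← smul_sub, ← smul_sub]
    congr 1
    rw [taylorRem]
    nth_rewrite 2 [hyR]
    rw [map_add]
    abel
  rw [htaylor]
  simp only [roughStep, add_smul, smul_sub, Finset.sum_add_distrib, Finset.sum_sub_distrib,
    hcross]
  rw [hyR, hR]
  abel

theorem roughStep_defect_bddLip (hV : BddC11 B V) (hVf : ∀ i, BddC21 B (Vf i))
    (hW : ∀ q, BddC11 B (iteratedField Vf q)) (hA : 0 ≤ A) (hε : 0 ≤ ε) (hεM : ε ≤ M)
    {Δ₁ Δ₂ : ℝ} {X₁ X₂ : ι → ℝ} {XX₁ XX₂ : ι × ι → ℝ}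
    (hΔ₁ : |Δ₁| ≤ A * ε ^ 2) (hX₁ : ∑ i, |X₁ i| ≤ A * ε) (hXX₁ : ∑ q, |XX₁ q| ≤ A * ε ^ 2)
    (hΔ₂ : |Δ₂| ≤ A * ε ^ 2) (hX₂ : ∑ i, |X₂ i| ≤ A * ε) (hXX₂ : ∑ q, |XX₂ q| ≤ A * ε ^ 2) :
    BddLip ((2 * A * B * (A * B * (1 + 2 * M)) ^ 2 + 4 * A ^ 2 * B ^ 2 +
        4 * A * B * (A * B * (1 + 2 * M))) * ε ^ 3)
      (fun x => roughStep V Vf Δ₁ X₁ XX₁ x +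
        roughStep V Vf Δ₂ X₂ XX₂ (x + roughStep V Vf Δ₁ X₁ XX₁ x) -
        roughStep V Vf (Δ₁ + Δ₂) (fun i => X₁ i + X₂ i)
          (fun q => XX₁ q + XX₂ q + X₁ q.1 * X₂ q.2) x) := by
  have hB := hV.1.nonneg
  have hM : 0 ≤ M := hε.trans hεM
  simp only [roughStep_defect_eq]
  have g1 := (roughStep_bddC11 hV (fun i => (hVf i).1) hW hA hε hεM hΔ₁ hX₁ hXX₁).1
  have r1 := (roughStep_rest_bddLip hV hW hΔ₁ hXX₁).1
  set P := A * B * (1 + 2 * M) with hP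
  have hP0 : 0 ≤ P := by positivity
  have t1 := BddLip.sum_smul Finset.univ X₂ fun k => (hVf k).taylorRem_bddLip g1
  have t2 := BddLip.sum_smul Finset.univ X₂ fun k => (hVf k).2.1.clm_apply r1
  have t3 := (hV.increment g1).smul Δ₂
  have t4 := BddLip.sum_smul Finset.univ XX₂ fun q => (hW q).increment g1
  refine (((t1.add t2).add t3).add t4).mono ?_
  calc _ ≤ (A * ε) * (2 * B * (P * ε) ^ 2) + (A * ε) * (2 * B * (2 * A * B * ε ^ 2)) +
        (A * ε ^ 2) * (2 * B * (P * ε)) + (A * ε ^ 2) * (2 * B * (P * ε)) := by gcongr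
    _ = _ := by ring

theorem sum_abs_le_card_mul_norm {κ : Type*} [Fintype κ] (v : EuclideanSpace ℝ κ) :
    ∑ i, |v i| ≤ Fintype.card κ * ‖v‖ := by
  calc ∑ i, |v i| ≤ ∑ _i : κ, ‖v‖ := Finset.sum_le_sum fun i _ => PiLp.norm_apply_le v i
    _ = _ := by simp

/-- Bounds on the increments of a rough path in terms of powers of `(t - s) ^ (1 / p)`. -/
structure IncrementBounds (T p A : ℝ) (X : ℝ → ℝ → EuclideanSpace ℝ ι)
    (XX : ℝ → ℝ → EuclideanSpace ℝ (ι × ι)) : Prop where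
  nonneg : 0 ≤ A
  time : ∀ s t : ℝ, 0 ≤ s → s ≤ t → t ≤ T → |t - s| ≤ A * ((t - s) ^ (1 / p)) ^ 2
  first : ∀ s t : ℝ, 0 ≤ s → s ≤ t → t ≤ T → ∑ i, |X t s i| ≤ A * (t - s) ^ (1 / p)
  second : ∀ s t : ℝ, 0 ≤ s → s ≤ t → t ≤ T → ∑ q, |XX t s q| ≤ A * ((t - s) ^ (1 / p)) ^ 2

theorem exists_incrementBounds {T p : ℝ} (hT : 0 < T) (hp : 2 ≤ p)
    {X : ℝ → ℝ → EuclideanSpace ℝ ι} {XX : ℝ → ℝ → EuclideanSpace ℝ (ι × ι)}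
    (hhol : ∃ K : ℝ, ∀ s t : ℝ, 0 ≤ s → s ≤ t → t ≤ T →
      ‖X t s‖ ≤ K * (t - s) ^ (1 / p) ∧ ‖XX t s‖ ≤ K * (t - s) ^ (2 / p)) :
    ∃ A, IncrementBounds T p A X XX := by
  obtain ⟨K, hK⟩ := hhol
  have hsq : ∀ r : ℝ, 0 ≤ r → (r ^ (1 / p)) ^ 2 = r ^ (2 / p) := by
    intro r hr
    rw [← Real.rpow_natCast, ← Real.rpow_mul hr]
    congr 1
    push_cast
    ring
  have hp2 : 0 ≤ 1 - 2 / p := by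
    rw [sub_nonneg, div_le_one (by linarith)]
    exact hp
  set A₁ : ℝ := T ^ (1 - 2 / p)
  set A₂ : ℝ := Fintype.card ι * |K|
  set A₃ : ℝ := Fintype.card (ι × ι) * |K|
  have h1 : 0 ≤ A₁ := by positivity
  have h2 : 0 ≤ A₂ := by positivity
  have h3 : 0 ≤ A₃ := by positivity
  refine ⟨A₁ + A₂ + A₃, by positivity, fun s t hs hst ht => ?_, fun s t hs hst ht => ?_,
    fun s t hs hst ht => ?_⟩
  · have hr : 0 ≤ t - s := by linarith
    rw [hsq _ hr, abs_of_nonneg hr]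
    calc t - s = (t - s) ^ (1 - 2 / p) * (t - s) ^ (2 / p) := by
          rw [← Real.rpow_add' hr (by simp), sub_add_cancel, Real.rpow_one]
      _ ≤ A₁ * (t - s) ^ (2 / p) := by
          gcongr
          exact Real.rpow_le_rpow hr (by linarith) hp2
      _ ≤ _ := by gcongr; linarith
  · have hr : 0 ≤ t - s := by linarith
    calc _ ≤ Fintype.card ι * ‖X t s‖ := sum_abs_le_card_mul_norm _
      _ ≤ Fintype.card ι * (|K| * (t - s) ^ (1 / p)) := by
          gcongr
          exact (hK s t hs hst ht).1.trans (by gcongr; exact le_abs_self K)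
      _ = A₂ * (t - s) ^ (1 / p) := by ring
      _ ≤ _ := by gcongr; linarith
  · have hr : 0 ≤ t - s := by linarith
    rw [hsq _ hr]
    calc _ ≤ Fintype.card (ι × ι) * ‖XX t s‖ := sum_abs_le_card_mul_norm _
      _ ≤ Fintype.card (ι × ι) * (|K| * (t - s) ^ (2 / p)) := by
          gcongr
          exact (hK s t hs hst ht).2.trans (by gcongr; exact le_abs_self K)
      _ = A₃ * (t - s) ^ (2 / p) := by ring
      _ ≤ _ := by gcongr; linarith

theorem exists_uniform_field_bound (hV : CkbMap 2 V) (hVf : ∀ i, CkbMap 3 (Vf i)) :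
    ∃ B, BddC11 B V ∧ (∀ i, BddC21 B (Vf i)) ∧ ∀ q, BddC11 B (iteratedField Vf q) := by
  obtain ⟨B₁, h1⟩ := hV.exists_bddC11
  choose B₂ h2 using fun i => (hVf i).exists_bddC21
  choose B₃ h3 using fun q : ι × ι =>
    ((hVf q.2).fderiv_right.clm_apply ((hVf q.1).of_le (by norm_num : 2 ≤ 3))).exists_bddC11
  have n1 := h1.1.nonneg
  have n2 : ∀ i, 0 ≤ B₂ i := fun i => (h2 i).1.1.nonneg
  have n3 : ∀ q, 0 ≤ B₃ q := fun q => (h3 q).1.nonneg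
  have s2 : 0 ≤ ∑ i, B₂ i := Finset.sum_nonneg fun i _ => n2 i
  have s3 : 0 ≤ ∑ q, B₃ q := Finset.sum_nonneg fun q _ => n3 q
  refine ⟨B₁ + ∑ i, B₂ i + ∑ q, B₃ q, h1.mono (by linarith), fun i => (h2 i).mono ?_,
    fun q => (h3 q).mono ?_⟩
  · have := Finset.single_le_sum (fun i _ => n2 i) (Finset.mem_univ i)
    linarith
  · have := Finset.single_le_sum (fun q _ => n3 q) (Finset.mem_univ q)
    linarith

theorem rpow_one_div_pow_three {r : ℝ} (hr : 0 ≤ r) (p : ℝ) :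
    (r ^ (1 / p)) ^ 3 = r ^ (3 / p) := by
  rw [← Real.rpow_natCast, ← Real.rpow_mul hr]
  congr 1
  push_cast
  ring

theorem exists_almostFlow_roughStep {T p : ℝ} (hp : 2 ≤ p)
    {X : ℝ → ℝ → EuclideanSpace ℝ ι} {XX : ℝ → ℝ → EuclideanSpace ℝ (ι × ι)}
    (hChen : ∀ s u t : ℝ, 0 ≤ s → s ≤ u → u ≤ t → t ≤ T →
      X t s = X t u + X u s ∧
      ∀ q : ι × ι, XX t s q = XX t u q + XX u s q + X u s q.1 * X t u q.2)
    (hA : IncrementBounds T p A X XX) (hV : BddC11 B V) (hVf : ∀ i, BddC21 B (Vf i))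
    (hW : ∀ q, BddC11 B (iteratedField Vf q)) :
    ∃ K, AlmostFlow T K (1 / p) (3 / p)
      (fun t s => roughStep V Vf (t - s) (X t s) (XX t s)) := by
  have hp0 : 0 ≤ 1 / p := by positivity
  set K₁ := A * B * (1 + 2 * T ^ (1 / p))
  set K₂ := 2 * A * B * K₁ ^ 2 + 4 * A ^ 2 * B ^ 2 + 4 * A * B * K₁
  refine ⟨max K₁ K₂, fun s t hs hst ht => ?_, fun s u t hs hsu hut ht => ?_⟩
  · have hr : 0 ≤ t - s := by linarith
    refine (roughStep_bddC11 hV (fun i => (hVf i).1) hW hA.nonneg (by positivity)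
      (Real.rpow_le_rpow hr (by linarith) hp0) (hA.time s t hs hst ht) (hA.first s t hs hst ht)
      (hA.second s t hs hst ht)).mono ?_
    gcongr
    exact le_max_left _ _
  · have hr : 0 ≤ t - s := by linarith
    have h1 : (u - s) ^ (1 / p) ≤ (t - s) ^ (1 / p) :=
      Real.rpow_le_rpow (by linarith) (by linarith) hp0
    have h2 : (t - u) ^ (1 / p) ≤ (t - s) ^ (1 / p) :=
      Real.rpow_le_rpow (by linarith) (by linarith) hp0
    have hA0 := hA.nonneg
    have n1 : 0 ≤ (u - s) ^ (1 / p) := Real.rpow_nonneg (by linarith) _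
    have n2 : 0 ≤ (t - u) ^ (1 / p) := Real.rpow_nonneg (by linarith) _
    have main := roughStep_defect_bddLip (ε := (t - s) ^ (1 / p)) hV hVf hW hA0 (by positivity)
      (Real.rpow_le_rpow hr (show t - s ≤ T by linarith) hp0)
      ((hA.time s u hs hsu (hut.trans ht)).trans (by gcongr))
      ((hA.first s u hs hsu (hut.trans ht)).trans (by gcongr))
      ((hA.second s u hs hsu (hut.trans ht)).trans (by gcongr))
      ((hA.time u t (hs.trans hsu) hut ht).trans (by gcongr))
      ((hA.first u t (hs.trans hsu) hut ht).trans (by gcongr))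
      ((hA.second u t (hs.trans hsu) hut ht).trans (by gcongr))
    have e1 : u - s + (t - u) = t - s := by ring
    have e2 : (fun i => X u s i + X t u i) = X t s := by
      funext i
      rw [(hChen s u t hs hsu hut ht).1]
      exact add_comm _ _
    have e3 : (fun q => XX u s q + XX t u q + X u s q.1 * X t u q.2) = XX t s := by
      funext q
      rw [(hChen s u t hs hsu hut ht).2 q, add_comm (XX u s q)]
    rw [e1, e2, e3, rpow_one_div_pow_three hr] at main
    refine main.mono ?_
    gcongr
    exact le_max_right _ _

theorem continuousOn_roughStep {S : Set (ℝ × ℝ)} {X : ℝ → ℝ → EuclideanSpace ℝ ι}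
    {XX : ℝ → ℝ → EuclideanSpace ℝ (ι × ι)}
    (hX : ContinuousOn (fun q : ℝ × ℝ => X q.2 q.1) S)
    (hXX : ContinuousOn (fun q : ℝ × ℝ => XX q.2 q.1) S) (x : E) :
    ContinuousOn (fun q : ℝ × ℝ =>
      roughStep V Vf (q.2 - q.1) (X q.2 q.1) (XX q.2 q.1) x) S := by
  have h1 : ∀ i, ContinuousOn (fun q : ℝ × ℝ => X q.2 q.1 i) S := fun i =>
    (PiLp.continuous_apply 2 _ i).comp_continuousOn hX
  have h2 : ∀ i, ContinuousOn (fun q : ℝ × ℝ => XX q.2 q.1 i) S := fun i =>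
    (PiLp.continuous_apply 2 _ i).comp_continuousOn hXX
  unfold roughStep
  fun_prop

end RoughStep

section Bridge

variable {E : Type*} [NormedAddCommGroup E] [NormedSpace ℝ E] {ι : Type*} [Fintype ι]
variable {V : E → E} {Vf : ι → E → E} {A B T p : ℝ} {f : E → ℝ}

theorem CkbMap.norm_iteratedFDeriv_le_C3norm (hf : CkbMap 3 f) {i : ℕ} (hi : i ≤ 3) (x : E) :
    ‖iteratedFDeriv ℝ i f x‖ ≤ C3norm f := by
  obtain ⟨M, hM⟩ := hf.2 i hi
  refine (le_ciSup (f := fun x => ‖iteratedFDeriv ℝ i f x‖) ⟨M, ?_⟩ x).trans ?_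
  · rintro _ ⟨y, rfl⟩
    exact hM y
  · exact Finset.single_le_sum (f := fun i => ⨆ x : E, ‖iteratedFDeriv ℝ i f x‖)
      (fun i _ => Real.iSup_nonneg fun x => norm_nonneg _) (Finset.mem_range.2 (by omega))

theorem CkbMap.bddLip_C3norm (hf : CkbMap 3 f) :
    BddLip (C3norm f) (fderiv ℝ f) ∧ BddLip (C3norm f) (fderiv ℝ (fderiv ℝ f)) := by
  have h1 : ∀ x, ‖fderiv ℝ f x‖ ≤ C3norm f := fun x => by
    simpa [← norm_iteratedFDeriv_fderiv] using
      hf.norm_iteratedFDeriv_le_C3norm (by norm_num : 1 ≤ 3) x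
  have h2 : ∀ x, ‖fderiv ℝ (fderiv ℝ f) x‖ ≤ C3norm f := fun x => by
    simpa [← norm_iteratedFDeriv_fderiv] using
      hf.norm_iteratedFDeriv_le_C3norm (by norm_num : 2 ≤ 3) x
  refine ⟨bddLip_of_fderiv_bound (hf.fderiv_right.differentiable two_ne_zero) h1 h2,
    bddLip_of_fderiv_bound (hf.fderiv_right.fderiv_right.differentiable one_ne_zero) h2
      fun x => ?_⟩
  rw [← norm_iteratedFDeriv_one, norm_iteratedFDeriv_fderiv, norm_iteratedFDeriv_fderiv]
  exact hf.norm_iteratedFDeriv_le_C3norm (le_refl 3) x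

theorem CkbMap.fderiv_fderiv_symm (hf : CkbMap 3 f) (x v w : E) :
    fderiv ℝ (fderiv ℝ f) x v w = fderiv ℝ (fderiv ℝ f) x w v :=
  second_derivative_symmetric (fun y => (hf.differentiable three_ne_zero y).hasFDerivAt)
    (hf.fderiv_right.differentiable two_ne_zero x).hasFDerivAt v w

theorem CkbMap.abs_second_order_taylor_le (hf : CkbMap 3 f) (x h : E) :
    |f (x + h) - f x - fderiv ℝ f x h - 2⁻¹ * fderiv ℝ (fderiv ℝ f) x h h| ≤
      C3norm f * ‖h‖ ^ 3 := by
  set D := fderiv ℝ (fderiv ℝ f) x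
  let R : E → ℝ := fun z => f (x + z) - f x - fderiv ℝ f x z - 2⁻¹ * D z z
  have hd : ∀ z, HasFDerivAt R (taylorRem (fderiv ℝ f) x z) z := fun z => by
    have h1 := (((hasFDerivAt_comp_add_left x).2
      (hf.differentiable three_ne_zero (x + z)).hasFDerivAt).sub_const (f x)).sub
        (fderiv ℝ f x).hasFDerivAt
    have h2 : HasFDerivAt (fun z => D z z) _ z := D.hasFDerivAt.clm_apply (hasFDerivAt_id z)
    refine (h1.sub (h2.const_mul (2⁻¹ : ℝ))).congr_fderiv ?_
    ext v
    have hs : D v z = D z v := hf.fderiv_fderiv_symm x v z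
    simp only [taylorRem, sub_apply, smul_apply,
      add_apply, ContinuousLinearMap.comp_apply,
      ContinuousLinearMap.flip_apply, ContinuousLinearMap.id_apply, smul_eq_mul, hs]
    ring
  have main := (convex_closedBall (0 : E) ‖h‖).norm_image_sub_le_of_norm_fderiv_le (𝕜 := ℝ)
    (C := C3norm f * ‖h‖ ^ 2) (fun z _ => (hd z).differentiableAt) (fun z hz => ?_)
    (show (0 : E) ∈ _ by simp) (show h ∈ _ by simp)
  · have h0 : R 0 = 0 := by simp [R]
    rw [h0, sub_zero, sub_zero, mul_assoc, ← pow_succ] at main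
    exact main
  · rw [(hd z).fderiv]
    refine (norm_taylorRem_le (hf.fderiv_right.differentiable two_ne_zero) hf.bddLip_C3norm.2 x z).trans ?_
    have := hf.bddLip_C3norm.1.nonneg
    gcongr
    simpa using hz

theorem CkbMap.abs_second_order_approx_le (hf : CkbMap 3 f) (x h w ξ : E) :
    |f (x + h) - f x - fderiv ℝ f x w - 2⁻¹ * fderiv ℝ (fderiv ℝ f) x ξ ξ| ≤
      C3norm f * (‖h‖ ^ 3 + ‖h - w‖ + ‖h - ξ‖ * (‖h‖ + ‖ξ‖)) := by
  obtain ⟨hb1, hb2⟩ := hf.bddLip_C3norm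
  set N := C3norm f
  have hN : 0 ≤ N := hb1.nonneg
  set D := fderiv ℝ (fderiv ℝ f) x with hD
  have t0 := hf.abs_second_order_taylor_le x h
  have t1 : ‖fderiv ℝ f x (h - w)‖ ≤ N * ‖h - w‖ :=
    (fderiv ℝ f x).le_of_opNorm_le (hb1.1 x) _
  have t2 : ‖D (h - ξ) h‖ ≤ N * ‖h - ξ‖ * ‖h‖ :=
    (D.le_opNorm₂ _ _).trans (by gcongr; exact hb2.1 x)
  have t3 : ‖D ξ (h - ξ)‖ ≤ N * ‖ξ‖ * ‖h - ξ‖ :=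
    (D.le_opNorm₂ _ _).trans (by gcongr; exact hb2.1 x)
  have key : f (x + h) - f x - fderiv ℝ f x w - 2⁻¹ * D ξ ξ =
      (f (x + h) - f x - fderiv ℝ f x h - 2⁻¹ * D h h) + fderiv ℝ f x (h - w) +
        2⁻¹ * (D (h - ξ) h + D ξ (h - ξ)) := by
    simp only [map_sub, sub_apply]
    ring
  rw [key]
  rw [Real.norm_eq_abs] at t1 t2 t3
  have n1 : 0 ≤ N * ‖h - ξ‖ * ‖h‖ := by positivity
  have n2 : 0 ≤ N * ‖ξ‖ * ‖h - ξ‖ := by positivity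
  rw [abs_le] at *
  constructor <;> nlinarith

theorem CkbMap.fderiv_apply_field (hf : CkbMap 3 f) (hVf : ∀ i, Differentiable ℝ (Vf i))
    (x : E) (j k : ι) :
    fderiv ℝ (fun y => fderiv ℝ f y (Vf k y)) x (Vf j x) =
      fderiv ℝ (fderiv ℝ f) x (Vf j x) (Vf k x) + fderiv ℝ f x (iteratedField Vf (j, k) x) := by
  have h := (hf.fderiv_right.differentiable two_ne_zero x).hasFDerivAt.clm_apply
    (hVf k x).hasFDerivAt
  rw [h.fderiv]
  simp [iteratedField, add_comm]

theorem CkbMap.expansion_eq (hf : CkbMap 3 f) (hVf : ∀ i, Differentiable ℝ (Vf i))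
    {Δ : ℝ} {X : ι → ℝ} {XX : ι × ι → ℝ}
    (hgeom : ∀ j k, XX (j, k) + XX (k, j) = X j * X k) (x : E) :
    Δ * fderiv ℝ f x (V x) + (∑ i, X i * fderiv ℝ f x (Vf i x)) +
        ∑ j, ∑ k, XX (j, k) * fderiv ℝ (fun y => fderiv ℝ f y (Vf k y)) x (Vf j x) =
      fderiv ℝ f x (roughStep V Vf Δ X XX x) +
        2⁻¹ * fderiv ℝ (fderiv ℝ f) x (∑ i, X i • Vf i x) (∑ i, X i • Vf i x) := by
  set D := fderiv ℝ (fderiv ℝ f) x with hD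
  have hsymm : ∑ j, ∑ k, XX (j, k) * D (Vf j x) (Vf k x) =
      2⁻¹ * D (∑ i, X i • Vf i x) (∑ i, X i • Vf i x) := by
    have e1 : D (∑ i, X i • Vf i x) (∑ i, X i • Vf i x) =
        ∑ j, ∑ k, X j * X k * D (Vf j x) (Vf k x) := by
      simp only [map_sum, map_smul, sum_apply,
        smul_apply, smul_eq_mul, Finset.mul_sum, mul_assoc]
      rw [Finset.sum_comm]
      exact Finset.sum_congr rfl fun j _ => Finset.sum_congr rfl fun k _ => by ring
    have e2 : ∑ j, ∑ k, XX (k, j) * D (Vf j x) (Vf k x) =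
        ∑ j, ∑ k, XX (j, k) * D (Vf j x) (Vf k x) := by
      rw [Finset.sum_comm]
      refine Finset.sum_congr rfl fun j _ => Finset.sum_congr rfl fun k _ => ?_
      rw [hD, hf.fderiv_fderiv_symm]
    simp only [e1, ← hgeom, add_mul, Finset.sum_add_distrib, e2]
    ring
  rw [← hsymm]
  simp only [hf.fderiv_apply_field hVf, roughStep, map_add, map_sum, map_smul, smul_eq_mul,
    mul_add, Finset.sum_add_distrib, Fintype.sum_prod_type]
  ring

theorem FollowsSteps.isSolutionPath {ℓ : ℕ} {Vf : Fin ℓ → E → E} (hp : 0 < p) (hp3 : p < 3)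
    {X : ℝ → ℝ → EuclideanSpace ℝ (Fin ℓ)} {XX : ℝ → ℝ → EuclideanSpace ℝ (Fin ℓ × Fin ℓ)}
    (hgeom : ∀ s t : ℝ, 0 ≤ s → s ≤ t → t ≤ T → ∀ j k : Fin ℓ,
      XX t s (j, k) + XX t s (k, j) = X t s j * X t s k)
    (hA : IncrementBounds T p A X XX) (hV : BddC11 B V) (hVf : ∀ i, BddC11 B (Vf i))
    (hVd : ∀ i, Differentiable ℝ (Vf i)) (hW : ∀ q, BddC11 B (iteratedField Vf q))
    {C δ : ℝ} (hC : 0 ≤ C) (hδ : 0 < δ) {x₀ : E} {z : ℝ → E} (hz0 : z 0 = x₀)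
    (hz : FollowsSteps T C δ (3 / p) (fun t s => roughStep V Vf (t - s) (X t s) (XX t s)) z) :
    IsSolutionPath ℓ T V Vf X XX x₀ z := by
  have hA0 := hA.nonneg
  have hB := hV.1.nonneg
  set M := δ ^ (1 / p)
  set Q := 2 * A * B + C * M
  set R := A * B + Q * M
  refine ⟨hz0, 3 / p, (one_lt_div hp).2 hp3, δ, hδ,
    R ^ 3 + C + Q * (R + A * B), by positivity, fun f hf s t hs hst ht hδt => ?_⟩
  have hr : 0 ≤ t - s := by linarith
  set ε := (t - s) ^ (1 / p) with hε
  have hε0 : 0 ≤ ε := by positivity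
  have hεM : ε ≤ M := Real.rpow_le_rpow hr hδt (by positivity)
  set x := z s
  set w := roughStep V Vf (t - s) (X t s) (XX t s) x with hw
  set ξ := ∑ i, X t s i • Vf i x with hξ
  have b1 : ‖z t - x - w‖ ≤ C * ε ^ 3 := by
    rw [rpow_one_div_pow_three hr, sub_sub]
    exact hz s t hs hst ht hδt
  have b2 : ‖w - ξ‖ ≤ 2 * A * B * ε ^ 2 := by
    have := (roughStep_rest_bddLip hV hW (hA.time s t hs hst ht) (hA.second s t hs hst ht)).1.1 x
    rwa [hw, roughStep, add_sub_cancel_left]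
  have b3 : ‖ξ‖ ≤ A * B * ε := by
    refine ((BddC11.sum_smul Finset.univ (X t s) hVf).1.1 x).trans ?_
    have := mul_le_mul_of_nonneg_right (hA.first s t hs hst ht) hB
    linarith
  have b4 : ‖z t - x - ξ‖ ≤ Q * ε ^ 2 := by
    calc ‖z t - x - ξ‖ ≤ ‖z t - x - w‖ + ‖w - ξ‖ := norm_sub_le_norm_sub_add_norm_sub _ _ _
      _ ≤ C * ε ^ 3 + 2 * A * B * ε ^ 2 := add_le_add b1 b2
      _ = C * ε * ε ^ 2 + 2 * A * B * ε ^ 2 := by ring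
      _ ≤ C * M * ε ^ 2 + 2 * A * B * ε ^ 2 := by gcongr
      _ = Q * ε ^ 2 := by ring
  have b5 : ‖z t - x‖ ≤ R * ε := by
    calc ‖z t - x‖ ≤ ‖z t - x - ξ‖ + ‖ξ‖ := by
          simpa using norm_add_le (z t - x - ξ) ξ
      _ ≤ Q * ε ^ 2 + A * B * ε := add_le_add b4 b3
      _ = Q * ε * ε + A * B * ε := by ring
      _ ≤ Q * M * ε + A * B * ε := by gcongr
      _ = R * ε := by ring
  have key := hf.abs_second_order_approx_le x (z t - x) w ξ
  have hexp := hf.expansion_eq (V := V) hVd (Δ := t - s) (hgeom s t hs hst ht) x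
  have hN : 0 ≤ C3norm f := hf.bddLip_C3norm.1.nonneg
  rw [add_sub_cancel] at key
  calc _ = |f (z t) - f x - fderiv ℝ f x w - 2⁻¹ * fderiv ℝ (fderiv ℝ f) x ξ ξ| := by
        congr 1
        rw [← hw, ← hξ] at hexp
        linarith
    _ ≤ _ := key
    _ ≤ C3norm f * ((R * ε) ^ 3 + C * ε ^ 3 + Q * ε ^ 2 * (R * ε + A * B * ε)) := by gcongr
    _ = (R ^ 3 + C + Q * (R + A * B)) * C3norm f * ε ^ 3 := by ring
    _ = _ := by rw [rpow_one_div_pow_three hr]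

end Bridge
section SineTest

variable {E : Type*} [NormedAddCommGroup E] [NormedSpace ℝ E]

theorem norm_iteratedFDeriv_sin_dual_le {φ : E →L[ℝ] ℝ} (hφ : ‖φ‖ ≤ 1) (x y : E) (i : ℕ) :
    ‖iteratedFDeriv ℝ i (fun y => Real.sin (φ (y - x))) y‖ ≤ 1 := by
  rw [iteratedFDeriv_comp_sub (f := fun y => Real.sin (φ y))]
  have h := φ.iteratedFDeriv_comp_right (f := Real.sin) (n := ⊤) Real.contDiff_sin (y - x)
    (i := i) le_top
  change ‖iteratedFDeriv ℝ i (Real.sin ∘ φ) (y - x)‖ ≤ 1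
  rw [h]
  refine (ContinuousMultilinearMap.norm_compContinuousLinearMap_le _ _).trans ?_
  rw [norm_iteratedFDeriv_eq_norm_iteratedDeriv]
  exact mul_le_one₀ (Real.abs_iteratedDeriv_sin_le_one i _) (by positivity)
    (Finset.prod_le_one (fun _ _ => norm_nonneg _) fun _ _ => hφ)

theorem ckbMap_sin_dual {φ : E →L[ℝ] ℝ} (hφ : ‖φ‖ ≤ 1) (x : E) (k : ℕ) :
    CkbMap k (fun y => Real.sin (φ (y - x))) :=
  ⟨Real.contDiff_sin.comp (φ.contDiff.comp (contDiff_id.sub contDiff_const)),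
    fun i _ => ⟨1, fun y => norm_iteratedFDeriv_sin_dual_le hφ x y i⟩⟩

theorem C3norm_sin_dual_le {φ : E →L[ℝ] ℝ} (hφ : ‖φ‖ ≤ 1) (x : E) :
    C3norm (fun y => Real.sin (φ (y - x))) ≤ 4 := by
  calc C3norm (fun y => Real.sin (φ (y - x))) ≤ ∑ _i ∈ Finset.range 4, (1 : ℝ) :=
        Finset.sum_le_sum fun i _ => ciSup_le fun y => norm_iteratedFDeriv_sin_dual_le hφ x y i
    _ = 4 := by norm_num

theorem hasFDerivAt_dual_sub (φ : E →L[ℝ] ℝ) (x y : E) :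
    HasFDerivAt (fun y => φ (y - x)) φ y := by
  simpa only [map_sub] using φ.hasFDerivAt.sub_const (φ x)

theorem fderiv_sin_dual (φ : E →L[ℝ] ℝ) (x : E) :
    fderiv ℝ (fun y => Real.sin (φ (y - x))) = fun y => Real.cos (φ (y - x)) • φ :=
  funext fun y => (hasFDerivAt_dual_sub φ x y).sin.fderiv

theorem fderiv_fderiv_sin_dual (φ : E →L[ℝ] ℝ) (x : E) :
    fderiv ℝ (fderiv ℝ (fun y => Real.sin (φ (y - x)))) x = 0 := by
  rw [fderiv_sin_dual, ((hasFDerivAt_dual_sub φ x x).cos.smul_const φ).fderiv]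
  ext
  simp

theorem abs_le_two_mul_of_abs_sin_mul_le {θ q : ℝ} (hq : q < 1)
    (h : ∀ r : ℝ, 0 ≤ r → r ≤ 1 → |Real.sin (r * θ)| ≤ q) : |θ| ≤ 2 * q := by
  have hπ := Real.pi_pos
  have hθ : |θ| ≤ Real.pi / 2 := by
    by_contra! hlt
    have hpos : 0 < |θ| := by linarith
    have h1 := h (Real.pi / 2 / |θ|) (by positivity) ((div_le_one hpos).2 hlt.le)
    have h2 : |Real.sin (Real.pi / 2 / |θ| * θ)| = 1 := by
      rcases abs_cases θ with ⟨e, _⟩ | ⟨e, _⟩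
      · rw [e] at hpos ⊢
        rw [div_mul_cancel₀ _ hpos.ne', Real.sin_pi_div_two, abs_one]
      · rw [e] at hpos ⊢
        rw [div_neg, neg_mul, div_mul_cancel₀ _ (by linarith), Real.sin_neg,
          Real.sin_pi_div_two, abs_neg, abs_one]
    linarith
  have h1 := Real.mul_abs_le_abs_sin hθ
  have h2 := h 1 zero_le_one le_rfl
  rw [one_mul] at h2
  have h3 : |θ| ≤ Real.pi / 2 * q := by
    calc |θ| = Real.pi / 2 * (2 / Real.pi * |θ|) := by field_simp
      _ ≤ Real.pi / 2 * q := by gcongr; linarith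
  have hq0 : 0 ≤ q := (abs_nonneg _).trans h2
  nlinarith [Real.pi_le_four]

theorem abs_sin_sub_self_le {θ : ℝ} (hθ : |θ| ≤ 1) : |Real.sin θ - θ| ≤ |θ| ^ 3 := by
  have h := Real.sin_bound hθ
  have h3 : |θ ^ 3 / 6| = |θ| ^ 3 / 6 := by rw [abs_div, abs_pow]; norm_num
  have h5 : |θ| ^ 5 ≤ |θ| ^ 3 := pow_le_pow_of_le_one (abs_nonneg _) hθ (by norm_num)
  have h0 : 0 ≤ |θ| ^ 3 := by positivity
  calc |Real.sin θ - θ| = |(Real.sin θ - (θ - θ ^ 3 / 6)) - θ ^ 3 / 6| := by congr 1; ring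
    _ ≤ |Real.sin θ - (θ - θ ^ 3 / 6)| + |θ ^ 3 / 6| := abs_sub _ _
    _ ≤ |θ| ^ 3 := by linarith

/-- If every functional of norm at most one sees `sin (φ h)` close to `φ w`, for `w` small, then
`h` is close to `w` up to a cubic error. -/
theorem norm_sub_le_of_abs_sin_dual_sub_le {h w : E} {η ρ : ℝ} (hρ : 2 * (η + ρ) ≤ 1)
    (hw : ‖w‖ ≤ ρ) (hφ : ∀ φ : E →L[ℝ] ℝ, ‖φ‖ ≤ 1 → |Real.sin (φ h) - φ w| ≤ η) :
    ‖h - w‖ ≤ η + (2 * (η + ρ)) ^ 3 := by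
  obtain ⟨φ, hφ1, hφ2⟩ := exists_dual_vector'' ℝ (h - w)
  have hsin : ∀ ψ : E →L[ℝ] ℝ, ‖ψ‖ ≤ 1 → |Real.sin (ψ h)| ≤ η + ρ := fun ψ hψ => by
    have h1 := hφ ψ hψ
    have h2 : ‖ψ w‖ ≤ 1 * ρ := ψ.le_of_opNorm_le_of_le hψ hw
    rw [Real.norm_eq_abs] at h2
    have h3 := abs_sub_abs_le_abs_sub (Real.sin (ψ h)) (ψ w)
    linarith
  have hθ : |φ h| ≤ 2 * (η + ρ) := by
    refine abs_le_two_mul_of_abs_sin_mul_le (by linarith) fun r hr0 hr1 => ?_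
    refine hsin (r • φ) ?_
    rw [norm_smul, Real.norm_eq_abs, abs_of_nonneg hr0]
    exact mul_le_one₀ hr1 (norm_nonneg _) hφ1
  have h1 := abs_sin_sub_self_le (hθ.trans hρ)
  have h2 : |φ h| ^ 3 ≤ (2 * (η + ρ)) ^ 3 := by gcongr
  have h3 : ‖h - w‖ = φ h - φ w := by
    rw [← map_sub, hφ2]
    rfl
  rw [h3]
  have h4 := hφ φ hφ1
  rw [abs_le] at h1 h4
  linarith [h1.1, h4.2]

variable {V : E → E} {A B T p : ℝ}

theorem IsSolutionPath.followsSteps {ℓ : ℕ} {Vf : Fin ℓ → E → E} (hp : 1 ≤ p) (hp3 : p < 3)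
    {X : ℝ → ℝ → EuclideanSpace ℝ (Fin ℓ)} {XX : ℝ → ℝ → EuclideanSpace ℝ (Fin ℓ × Fin ℓ)}
    (hgeom : ∀ s t : ℝ, 0 ≤ s → s ≤ t → t ≤ T → ∀ j k : Fin ℓ,
      XX t s (j, k) + XX t s (k, j) = X t s j * X t s k)
    (hA : IncrementBounds T p A X XX) (hV : BddC11 B V) (hVf : ∀ i, BddC11 B (Vf i))
    (hVd : ∀ i, Differentiable ℝ (Vf i)) (hW : ∀ q, BddC11 B (iteratedField Vf q))
    {x₀ : E} {z : ℝ → E} (hz : IsSolutionPath ℓ T V Vf X XX x₀ z) :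
    ∃ c C δ, 1 < c ∧ 0 ≤ C ∧ 0 < δ ∧
      FollowsSteps T C δ c (fun t s => roughStep V Vf (t - s) (X t s) (XX t s)) z := by
  obtain ⟨-, a, ha, δ, hδ, c, hc, hexp⟩ := hz
  have hA0 := hA.nonneg
  have hB := hV.1.nonneg
  have hp0 : 0 < p := by linarith
  set P := A * B * (1 + 2 * 1)
  have hP : 0 ≤ P := by positivity
  set S := 2 * (4 * c + P) + 1
  have hS : 1 ≤ S := by
    have : 0 ≤ 2 * (4 * c + P) := by positivity
    linarith
  have hS0 : 0 < S := by linarith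
  refine ⟨min a (3 / p), 4 * c + S ^ 3, min δ (S ^ (-p)), lt_min ha ((one_lt_div hp0).2 hp3),
    by positivity, lt_min hδ (by positivity), fun s t hs hst ht hδt => ?_⟩
  have hr : 0 ≤ t - s := by linarith
  have hr1 : t - s ≤ 1 := hδt.trans ((min_le_right _ _).trans
    (Real.rpow_le_one_of_one_le_of_nonpos hS (by linarith)))
  set ε := (t - s) ^ (1 / p) with hε
  have hε0 : 0 ≤ ε := by positivity
  have hεS : S * ε ≤ 1 := by
    have h1 : ε ≤ (S ^ (-p)) ^ (1 / p) :=
      Real.rpow_le_rpow hr (hδt.trans (min_le_right _ _)) (by positivity)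
    rw [← Real.rpow_mul hS0.le, mul_one_div, neg_div, div_self hp0.ne', Real.rpow_neg_one] at h1
    calc S * ε ≤ S * S⁻¹ := by gcongr
      _ = 1 := mul_inv_cancel₀ hS0.ne'
  have hmono : ∀ u v : ℝ, 0 < u → u ≤ v → (t - s) ^ v ≤ (t - s) ^ u := fun u v hu huv =>
    Real.rpow_le_rpow_of_exponent_ge_of_imp hr hr1 huv fun _ h => absurd h (hu.trans_le huv).ne'
  have hε1 : ε ≤ 1 := Real.rpow_le_one hr hr1 (by positivity)
  have hpa : 1 / p ≤ a := ((div_le_one hp0).2 hp).trans ha.le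
  have haε : (t - s) ^ a ≤ ε := hmono _ _ (by positivity) hpa
  set w := roughStep V Vf (t - s) (X t s) (XX t s) (z s) with hw
  have hwε : ‖w‖ ≤ P * ε := (roughStep_bddC11 hV hVf hW hA0 hε0 hε1
    (hA.time s t hs hst ht) (hA.first s t hs hst ht) (hA.second s t hs hst ht)).1.1 (z s)
  have hηρ : 2 * (4 * c * (t - s) ^ a + P * ε) ≤ S * ε := by
    calc 2 * (4 * c * (t - s) ^ a + P * ε) ≤ 2 * (4 * c * ε + P * ε) := by gcongr
      _ ≤ S * ε := by linarith
  have main := norm_sub_le_of_abs_sin_dual_sub_le (h := z t - z s) (hηρ.trans hεS) hwε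
    fun φ hφ => ?_
  · calc ‖z t - (z s + w)‖ = ‖z t - z s - w‖ := by rw [sub_sub]
      _ ≤ 4 * c * (t - s) ^ a + (2 * (4 * c * (t - s) ^ a + P * ε)) ^ 3 := main
      _ ≤ 4 * c * (t - s) ^ a + (S * ε) ^ 3 := by gcongr
      _ = 4 * c * (t - s) ^ a + S ^ 3 * (t - s) ^ (3 / p) := by
          rw [mul_pow, rpow_one_div_pow_three hr]
      _ ≤ 4 * c * (t - s) ^ min a (3 / p) + S ^ 3 * (t - s) ^ min a (3 / p) := by
          have hm : 0 < min a (3 / p) := lt_min (by linarith) (by positivity)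
          exact add_le_add
            (mul_le_mul_of_nonneg_left (hmono _ _ hm (min_le_left _ _)) (by positivity))
            (mul_le_mul_of_nonneg_left (hmono _ _ hm (min_le_right _ _)) (by positivity))
      _ = _ := by ring
  · have hf := ckbMap_sin_dual hφ (z s) 3
    have h1 := hexp _ hf s t hs hst ht (hδt.trans (min_le_left _ _))
    have h2 := hf.expansion_eq (V := V) hVd (Δ := t - s) (hgeom s t hs hst ht) (z s)
    rw [fderiv_fderiv_sin_dual] at h2
    have h3 : fderiv ℝ (fun y => Real.sin (φ (y - z s))) (z s) w = φ w := by
      rw [fderiv_sin_dual]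
      simp
    rw [← hw, h3] at h2
    calc _ = _ := by
          congr 1
          simp only [zero_apply, mul_zero, add_zero, sub_self, map_zero, Real.sin_zero] at h2 ⊢
          rw [sub_sub, sub_sub, ← add_assoc, h2, sub_zero]
      _ ≤ _ := h1
      _ ≤ c * 4 * (t - s) ^ a := by
          gcongr
          exact C3norm_sin_dual_le hφ _
      _ = _ := by ring

end SineTest

/-- **Lyons' universal limit theorem (existence and uniqueness of solution paths).**
For every initial condition there is exactly one solution path of the rough
differential equation `dz = V dt + F X(dt)` driven by a weak geometric Hölder
`p`-rough path, `2 ≤ p < 3`. -/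
theorem lyons_universal_limit_existence_uniqueness
    (ℓ : ℕ) (T p : ℝ) (hT : 0 < T) (hp1 : 2 ≤ p) (hp2 : p < 3)
    (V : E → E) (Vf : Fin ℓ → E → E)
    (hV : CkbMap 2 V) (hVf : ∀ i, CkbMap 3 (Vf i))
    (X : ℝ → ℝ → EuclideanSpace ℝ (Fin ℓ))
    (XX : ℝ → ℝ → EuclideanSpace ℝ (Fin ℓ × Fin ℓ))
    (hXcont : ContinuousOn (fun q : ℝ × ℝ => X q.2 q.1)
      {q : ℝ × ℝ | 0 ≤ q.1 ∧ q.1 ≤ q.2 ∧ q.2 ≤ T})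
    (hXXcont : ContinuousOn (fun q : ℝ × ℝ => XX q.2 q.1)
      {q : ℝ × ℝ | 0 ≤ q.1 ∧ q.1 ≤ q.2 ∧ q.2 ≤ T})
    (hChen : ∀ s u t : ℝ, 0 ≤ s → s ≤ u → u ≤ t → t ≤ T →
      X t s = X t u + X u s ∧
      ∀ q : Fin ℓ × Fin ℓ, XX t s q = XX t u q + XX u s q + X u s q.1 * X t u q.2)
    (hgeom : ∀ s t : ℝ, 0 ≤ s → s ≤ t → t ≤ T → ∀ j k : Fin ℓ,
      XX t s (j, k) + XX t s (k, j) = X t s j * X t s k)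
    (hhol : ∃ K : ℝ, ∀ s t : ℝ, 0 ≤ s → s ≤ t → t ≤ T →
      ‖X t s‖ ≤ K * (t - s) ^ (1 / p) ∧ ‖XX t s‖ ≤ K * (t - s) ^ (2 / p))
    (x₀ : E) :
    ∃ z : ℝ → E, IsSolutionPath ℓ T V Vf X XX x₀ z ∧
      ∀ z' : ℝ → E, IsSolutionPath ℓ T V Vf X XX x₀ z' →
        ∀ t : ℝ, 0 ≤ t → t ≤ T → z' t = z t := by
  have hp0 : 0 < p := by linarith
  obtain ⟨A, hA⟩ := exists_incrementBounds hT hp1 hhol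
  obtain ⟨B, hVB, hVfB, hW⟩ := exists_uniform_field_bound hV hVf
  have hVd : ∀ i, Differentiable ℝ (Vf i) := fun i => (hVf i).differentiable three_ne_zero
  obtain ⟨K, hK⟩ := exists_almostFlow_roughStep hp1 hChen hA hVB hVfB hW
  obtain ⟨z, hz0, ⟨C, δ, hC, hδ, hz⟩, huniq⟩ := hK.exists_unique_followsSteps hT
    (by positivity) ((one_lt_div hp0).2 hp2) (continuousOn_roughStep hXcont hXXcont) x₀
  exact ⟨z, hz.isSolutionPath hp0 hp2 hgeom hA hVB (fun i => (hVfB i).1) hVd hW hC hδ hz0,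
    fun z' hz' => huniq z' hz'.1
      (hz'.followsSteps (by linarith) hp2 hgeom hA hVB (fun i => (hVfB i).1) hVd hW)⟩
end
end

section
/- (Besov-type embedding, Garsia–Rodemich–Rumsey.) For every α ∈ [0,1/2) there exist a positive integer k and a constant C > 0 with the following property: for every metric space (S,d) and every continuous path x : [0,1] → S, one has sup_{0≤s<t≤1} d(x_s,x_t)/(t−s)^α ≤ C ( ∫₀¹∫₀¹ ( d(x_s,x_t)/|t−s|^{1/2} )^{2k} ds dt )^{1/(2k)} (the inequality being trivially true when the right-hand side is infinite). -/
open MeasureTheory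

/-!
Statement 17: Besov-type embedding (Garsia–Rodemich–Rumsey).  The right-hand side is
taken in `ℝ≥0∞` so that the inequality is trivially true when the integral is infinite.
-/

open scoped ENNReal Topology

/-- The uniform probability measure on the interval `[a, a + h]`. -/
noncomputable def uniformIcc (a h : ℝ) : Measure ℝ :=
  (ENNReal.ofReal h)⁻¹ • volume.restrict (Set.Icc a (a + h))

lemma isProbabilityMeasure_uniformIcc (a : ℝ) {h : ℝ} (hh : 0 < h) :
    IsProbabilityMeasure (uniformIcc a h) := by
  refine ⟨?_⟩
  simp only [uniformIcc, Measure.smul_apply, Measure.restrict_apply_univ, Real.volume_Icc,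
    add_sub_cancel_left, smul_eq_mul]
  exact ENNReal.inv_mul_cancel (by simpa using hh) ENNReal.ofReal_ne_top

lemma ae_mem_uniformIcc (a h : ℝ) : ∀ᵐ u ∂uniformIcc a h, u ∈ Set.Icc a (a + h) :=
  Measure.ae_smul_measure (ae_restrict_mem measurableSet_Icc) _

/-- A triangle inequality for averaged distances. -/
lemma lintegral_edist_le {S : Type*} [PseudoEMetricSpace S] {y : ℝ → S} (hy : Continuous y)
    (μ ν : Measure ℝ) [IsProbabilityMeasure μ] [IsProbabilityMeasure ν] (p : S) :
    ∫⁻ u, edist p (y u) ∂μ ≤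
      ∫⁻ v, edist p (y v) ∂ν + ∫⁻ u, ∫⁻ v, edist (y u) (y v) ∂ν ∂μ := by
  have hm : Measurable fun v => edist p (y v) := (continuous_const.edist hy).measurable
  calc ∫⁻ u, edist p (y u) ∂μ
      = ∫⁻ u, ∫⁻ _, edist p (y u) ∂ν ∂μ := by simp
    _ ≤ ∫⁻ u, ∫⁻ v, (edist p (y v) + edist (y u) (y v)) ∂ν ∂μ := by
        refine lintegral_mono fun u => lintegral_mono fun v => ?_
        rw [edist_comm (y u)]
        exact edist_triangle _ _ _
    _ = ∫⁻ u, (∫⁻ v, edist p (y v) ∂ν + ∫⁻ v, edist (y u) (y v) ∂ν) ∂μ := by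
        simp_rw [lintegral_add_left hm]
    _ = _ := by rw [lintegral_add_left measurable_const]; simp

/-- The Besov-type energy of a path. -/
noncomputable def besovEnergy {S : Type*} [PseudoMetricSpace S] (k : ℕ) (y : ℝ → S) : ℝ≥0∞ :=
  ∫⁻ s in Set.Icc (0:ℝ) 1, ∫⁻ t in Set.Icc (0:ℝ) 1,
    ENNReal.ofReal ((dist (y s) (y t) / |t - s| ^ ((1:ℝ) / 2)) ^ (2 * k))

lemma le_add_div_mul_pow {d l : ℝ} (hd : 0 ≤ d) (hl : 0 < l) {n : ℕ} (hn : 0 < n) :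
    d ≤ l + l / l ^ n * d ^ n := by
  rcases le_total d l with h | h
  · have : 0 ≤ l / l ^ n * d ^ n := by positivity
    linarith
  · obtain ⟨m, rfl⟩ : ∃ m, n = m + 1 := ⟨n - 1, by omega⟩
    have h1 : l / l ^ (m + 1) * d ^ (m + 1) = d * (d / l) ^ m := by
      rw [div_pow]
      field_simp
      ring
    have h2 : 1 ≤ (d / l) ^ m := one_le_pow₀ ((one_le_div hl).2 h)
    rw [h1]
    nlinarith

lemma dist_pow_le {S : Type*} [PseudoMetricSpace S] (y : ℝ → S) {k : ℕ} (hk : 0 < k)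
    {u v h : ℝ} (huv : |v - u| ≤ h) :
    dist (y u) (y v) ^ (2 * k) ≤
      h ^ k * (dist (y u) (y v) / |v - u| ^ ((1:ℝ) / 2)) ^ (2 * k) := by
  have h0 : 0 ≤ h := (abs_nonneg _).trans huv
  rcases eq_or_ne v u with rfl | hne
  · rw [dist_self, zero_pow (by omega)]
    positivity
  · have hpos : 0 < |v - u| := abs_pos.2 (sub_ne_zero.2 hne)
    have hs : (|v - u| ^ ((1:ℝ) / 2)) ^ (2 * k) = |v - u| ^ k := by
      rw [pow_mul, ← Real.sqrt_eq_rpow, Real.sq_sqrt hpos.le]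
    rw [div_pow, hs, ← mul_div_assoc, le_div_iff₀ (by positivity), mul_comm]
    gcongr

lemma lintegral_uniformIcc_edist_le {S : Type*} [PseudoMetricSpace S] (y : ℝ → S) {k : ℕ}
    (hk : 0 < k) {a c h b l : ℝ} (hh : 0 < h) (hl : 0 < l) (ha : 0 ≤ a) (hah : a + h ≤ 1)
    (hsub : Set.Icc c (c + h / 2) ⊆ Set.Icc a (a + h)) (hb : 0 ≤ b)
    (hB : besovEnergy k y ≤ ENNReal.ofReal b) (hbl : l ^ (2 * k) * h ^ 2 = b * h ^ k) :
    ∫⁻ u, ∫⁻ v, edist (y u) (y v) ∂uniformIcc c (h / 2) ∂uniformIcc a h ≤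
      ENNReal.ofReal (3 * l) := by
  have := isProbabilityMeasure_uniformIcc a hh
  have := isProbabilityMeasure_uniformIcc c (half_pos hh)
  set G : ℝ → ℝ → ℝ≥0∞ := fun u v =>
    ENNReal.ofReal ((dist (y u) (y v) / |v - u| ^ ((1:ℝ) / 2)) ^ (2 * k)) with hG
  set K : ℝ := l / l ^ (2 * k) * h ^ k with hK
  have hK0 : 0 ≤ K := by positivity
  have hIsub : Set.Icc a (a + h) ⊆ Set.Icc 0 1 := Set.Icc_subset_Icc ha hah
  have hpt : ∀ u ∈ Set.Icc a (a + h), ∀ v ∈ Set.Icc c (c + h / 2),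
      edist (y u) (y v) ≤ ENNReal.ofReal l + ENNReal.ofReal K * G u v := by
    intro u hu v hv
    have hv' := hsub hv
    have huv : |v - u| ≤ h := by
      rw [abs_le]; constructor <;> linarith [hu.1, hu.2, hv'.1, hv'.2]
    rw [hG, edist_dist, ← ENNReal.ofReal_mul hK0,
      ← ENNReal.ofReal_add hl.le (mul_nonneg hK0 (by positivity))]
    refine ENNReal.ofReal_le_ofReal ?_
    refine (le_add_div_mul_pow dist_nonneg hl (n := 2 * k) (by omega)).trans ?_
    rw [hK, mul_assoc (l / l ^ (2 * k))]
    gcongr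
    exact dist_pow_le y hk huv
  have hGint : ∫⁻ u, ∫⁻ v, G u v ∂uniformIcc c (h / 2) ∂uniformIcc a h ≤
      ENNReal.ofReal (h⁻¹ * (h / 2)⁻¹ * b) := by
    simp only [uniformIcc, lintegral_smul_measure, smul_eq_mul]
    rw [lintegral_const_mul' _ _ (by simpa using hh), ← mul_assoc,
      ENNReal.ofReal_mul (by positivity), ENNReal.ofReal_mul (by positivity),
      ENNReal.ofReal_inv_of_pos hh, ENNReal.ofReal_inv_of_pos (half_pos hh)]
    gcongr
    refine le_trans ?_ hB
    exact (lintegral_mono fun u => lintegral_mono_set (hsub.trans hIsub)).trans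
      (lintegral_mono_set hIsub)
  calc ∫⁻ u, ∫⁻ v, edist (y u) (y v) ∂uniformIcc c (h / 2) ∂uniformIcc a h
      ≤ ∫⁻ u, ∫⁻ v, (ENNReal.ofReal l + ENNReal.ofReal K * G u v)
          ∂uniformIcc c (h / 2) ∂uniformIcc a h := by
        refine lintegral_mono_ae ((ae_mem_uniformIcc a h).mono fun u hu => ?_)
        exact lintegral_mono_ae ((ae_mem_uniformIcc c (h / 2)).mono fun v hv => hpt u hu v hv)
    _ = ENNReal.ofReal l + ENNReal.ofReal K *
          ∫⁻ u, ∫⁻ v, G u v ∂uniformIcc c (h / 2) ∂uniformIcc a h := by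
        simp_rw [lintegral_add_left measurable_const,
          lintegral_const_mul' _ _ ENNReal.ofReal_ne_top]
        simp
    _ ≤ ENNReal.ofReal l + ENNReal.ofReal K * ENNReal.ofReal (h⁻¹ * (h / 2)⁻¹ * b) := by gcongr
    _ = ENNReal.ofReal (3 * l) := by
        rw [← ENNReal.ofReal_mul hK0, ← ENNReal.ofReal_add hl.le (by positivity)]
        congr 1
        rw [hK]
        field_simp
        linear_combination (-2) * hbl

/-- Telescoping the averaged distances along intervals that shrink to the point `z`. -/
lemma lintegral_uniformIcc_edist_point_le {S : Type*} [PseudoMetricSpace S] {y : ℝ → S}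
    (hy : Continuous y) {k : ℕ} (hk : 2 < k) {a : ℕ → ℝ} {h b z : ℝ} (hh : 0 < h)
    (ha : 0 ≤ a 0) (hah : a 0 + h ≤ 1)
    (hsub : ∀ n, Set.Icc (a (n + 1)) (a (n + 1) + h / 2 ^ (n + 1)) ⊆
      Set.Icc (a n) (a n + h / 2 ^ n))
    (hz : ∀ n, z ∈ Set.Icc (a n) (a n + h / 2 ^ n)) (hb : 0 < b)
    (hB : besovEnergy k y ≤ ENNReal.ofReal b) :
    ∫⁻ u, edist (y z) (y u) ∂uniformIcc (a 0) h ≤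
      ENNReal.ofReal (3 * (1 - (1 / 2 : ℝ) ^ ((1:ℝ) / 2 - 1 / k))⁻¹ *
        (b ^ ((1:ℝ) / (2 * k)) * h ^ ((1:ℝ) / 2 - 1 / k))) := by
  have hk' : (2:ℝ) < k := by exact_mod_cast hk
  set γ : ℝ := (1:ℝ) / 2 - 1 / k with hγ
  have hγ0 : 0 < γ := by
    have : (1:ℝ) / k < 1 / 2 := one_div_lt_one_div_of_lt (by norm_num) hk'
    linarith
  set r : ℝ := (1 / 2 : ℝ) ^ γ with hr
  have hr0 : 0 < r := by positivity
  have hr1 : r < 1 := Real.rpow_lt_one (by norm_num) (by norm_num) hγ0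
  set l : ℝ := b ^ ((1:ℝ) / (2 * k)) * h ^ γ with hl
  have hl0 : 0 < l := by positivity
  have hpos : ∀ n : ℕ, 0 < h / 2 ^ n := fun n => by positivity
  have hIcc : ∀ n, Set.Icc (a n) (a n + h / 2 ^ n) ⊆ Set.Icc 0 1 := by
    intro n
    induction n with
    | zero => exact Set.Icc_subset_Icc ha (by simpa using hah)
    | succ n ih => exact (hsub n).trans ih
  have hscale : ∀ n : ℕ, b ^ ((1:ℝ) / (2 * k)) * (h / 2 ^ n) ^ γ = l * r ^ n := by
    intro n
    rw [hl, hr, div_eq_mul_inv h, Real.mul_rpow hh.le (by positivity), ← Real.rpow_natCast (_ ^ γ),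
      ← Real.rpow_mul (by norm_num), mul_comm γ, Real.rpow_mul (by norm_num), Real.rpow_natCast,
      one_div_pow, one_div ((2:ℝ) ^ n), mul_assoc]
  have hbl : ∀ g : ℝ, 0 < g →
      (b ^ ((1:ℝ) / (2 * k)) * g ^ γ) ^ (2 * k) * g ^ 2 = b * g ^ k := by
    intro g hg
    have e1 : (b ^ ((1:ℝ) / (2 * k))) ^ (2 * k) = b := by
      rw [← Real.rpow_natCast, ← Real.rpow_mul hb.le]
      push_cast
      rw [one_div_mul_cancel (by positivity), Real.rpow_one]
    have e2 : (g ^ γ) ^ (2 * k) * g ^ 2 = g ^ k := by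
      rw [← Real.rpow_natCast, ← Real.rpow_mul hg.le, ← Real.rpow_natCast, ← Real.rpow_add hg,
        ← Real.rpow_natCast]
      congr 1
      push_cast
      rw [hγ]
      field_simp
      ring
    rw [mul_pow, e1, mul_assoc, e2]
  have hstep : ∀ n : ℕ, ∫⁻ u, edist (y z) (y u) ∂uniformIcc (a n) (h / 2 ^ n) ≤
      ∫⁻ u, edist (y z) (y u) ∂uniformIcc (a (n + 1)) (h / 2 ^ (n + 1)) +
        ENNReal.ofReal (3 * (l * r ^ n)) := by
    intro n
    have := isProbabilityMeasure_uniformIcc (a n) (hpos n)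
    have := isProbabilityMeasure_uniformIcc (a (n + 1)) (hpos (n + 1))
    refine (lintegral_edist_le hy _ (uniformIcc (a (n + 1)) (h / 2 ^ (n + 1))) (y z)).trans ?_
    gcongr
    have hhalf : h / 2 ^ (n + 1) = h / 2 ^ n / 2 := by rw [pow_succ, div_mul_eq_div_div]
    have hs := hsub n
    rw [hhalf] at hs ⊢
    have hmem := (Set.Icc_subset_Icc_iff (by linarith [hpos n])).1 (hIcc n)
    refine lintegral_uniformIcc_edist_le y (by omega) (hpos n) (by positivity) hmem.1 hmem.2 hs
      hb.le hB ?_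
    rw [← hscale]
    exact hbl _ (hpos n)
  have hsum : ∀ n : ℕ, ∫⁻ u, edist (y z) (y u) ∂uniformIcc (a 0) h ≤
      ∫⁻ u, edist (y z) (y u) ∂uniformIcc (a n) (h / 2 ^ n) +
        ENNReal.ofReal (∑ i ∈ Finset.range n, 3 * (l * r ^ i)) := by
    intro n
    induction n with
    | zero => simp
    | succ n ih =>
      refine ih.trans ?_
      rw [Finset.sum_range_succ, ENNReal.ofReal_add
        (Finset.sum_nonneg fun i _ => by positivity) (by positivity),
        add_comm (ENNReal.ofReal (∑ i ∈ Finset.range n, _)), ← add_assoc]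
      gcongr
      exact hstep n
  have hgeom : ∀ n : ℕ, ∑ i ∈ Finset.range n, 3 * (l * r ^ i) ≤ 3 * (1 - r)⁻¹ * l := by
    intro n
    rw [← Finset.mul_sum, ← Finset.mul_sum, mul_assoc 3, mul_comm (1 - r)⁻¹]
    have : ∑ i ∈ Finset.range n, r ^ i ≤ (1 - r)⁻¹ := by
      rw [← tsum_geometric_of_lt_one hr0.le hr1]
      exact (summable_geometric_of_lt_one hr0.le hr1).sum_le_tsum _ fun i _ => by positivity
    gcongr
  refine ENNReal.le_of_forall_pos_le_add fun ε hε _ => ?_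
  obtain ⟨δ, hδ, hyδ⟩ := Metric.continuousAt_iff.1 (hy.continuousAt (x := z)) ε hε
  obtain ⟨n, hn⟩ : ∃ n : ℕ, h / 2 ^ n < δ := by
    obtain ⟨n, hn⟩ := exists_pow_lt_of_lt_one (div_pos hδ hh) (by norm_num : (1 / 2 : ℝ) < 1)
    refine ⟨n, ?_⟩
    rw [lt_div_iff₀ hh, one_div_pow] at hn
    rwa [div_eq_mul_one_div, mul_comm]
  have := isProbabilityMeasure_uniformIcc (a n) (hpos n)
  have hsmall : ∫⁻ u, edist (y z) (y u) ∂uniformIcc (a n) (h / 2 ^ n) ≤ ε := by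
    calc ∫⁻ u, edist (y z) (y u) ∂uniformIcc (a n) (h / 2 ^ n)
        ≤ ∫⁻ _, (ε : ℝ≥0∞) ∂uniformIcc (a n) (h / 2 ^ n) := by
          refine lintegral_mono_ae ((ae_mem_uniformIcc _ _).mono fun u hu => ?_)
          have hzu : dist u z < δ := by
            rw [Real.dist_eq, abs_lt]
            constructor <;> linarith [hu.1, hu.2, (hz n).1, (hz n).2]
          rw [edist_comm, edist_le_coe, ← NNReal.coe_le_coe, coe_nndist]
          exact (hyδ hzu).le
      _ = ε := by simp
  rw [add_comm]
  exact (hsum n).trans (add_le_add hsmall (ENNReal.ofReal_le_ofReal (hgeom n)))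

/-- **Besov embedding.**  For every `α ∈ [0, 1/2)` there are `k ≥ 1` and `C > 0` such
that, for every metric space `S` and continuous path `x : [0,1] → S`,
`sup_{s<t} d(x_s, x_t)/(t-s)^α ≤ C (∫₀¹∫₀¹ (d(x_s, x_t)/|t-s|^{1/2})^{2k} ds dt)^{1/(2k)}`. -/
theorem besov_embedding (α : ℝ) (hα0 : 0 ≤ α) (hα : α < 1 / 2) :
    ∃ k : ℕ, 0 < k ∧ ∃ C : ℝ, 0 < C ∧
      ∀ (S : Type) [MetricSpace S], ∀ x : ℝ → S, ContinuousOn x (Set.Icc 0 1) →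
        ∀ s t : ℝ, 0 ≤ s → s < t → t ≤ 1 →
          ENNReal.ofReal (dist (x s) (x t) / (t - s) ^ α) ≤
            ENNReal.ofReal C *
              (∫⁻ s' in Set.Icc (0:ℝ) 1, ∫⁻ t' in Set.Icc (0:ℝ) 1,
                ENNReal.ofReal
                  ((dist (x s') (x t') / |t' - s'| ^ ((1:ℝ) / 2)) ^ (2 * k))) ^
                ((1:ℝ) / (2 * (k:ℝ))) := by
  obtain ⟨k, hk⟩ := exists_nat_gt (2 / (1 - 2 * α))
  have hα' : 0 < 1 - 2 * α := by linarith
  have hk2 : (2:ℝ) < k := by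
    refine lt_of_le_of_lt ?_ hk
    rw [le_div_iff₀ hα']
    linarith
  have hk2' : 2 < k := by exact_mod_cast hk2
  have hk0 : (0:ℝ) < k := by linarith
  have hγα : α ≤ (1:ℝ) / 2 - 1 / k := by
    have h1 : (1:ℝ) / k < (1 - 2 * α) / 2 := by
      rw [div_lt_iff₀ hα'] at hk
      rw [div_lt_iff₀ hk0]
      linarith
    linarith
  set γ : ℝ := (1:ℝ) / 2 - 1 / k with hγ
  have hγ0 : 0 < γ := by
    have : (1:ℝ) / k < 1 / 2 := one_div_lt_one_div_of_lt (by norm_num) hk2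
    linarith
  have hr1 : (1 / 2 : ℝ) ^ γ < 1 := Real.rpow_lt_one (by norm_num) (by norm_num) hγ0
  set D : ℝ := 3 * (1 - (1 / 2 : ℝ) ^ γ)⁻¹ with hD
  have hD0 : 0 < D := mul_pos (by norm_num) (inv_pos.2 (by linarith))
  refine ⟨k, by omega, 2 * D, by positivity, ?_⟩
  intro S _ x hx s t hs hst ht
  set y : ℝ → S := Set.IccExtend zero_le_one ((Set.Icc (0:ℝ) 1).domRestrict x) with hy
  have hyc : Continuous y := (continuousOn_iff_continuous_domRestrict.1 hx).Icc_extend'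
  have hyx : ∀ u ∈ Set.Icc (0:ℝ) 1, y u = x u := fun u hu => Set.IccExtend_of_mem _ _ hu
  have hE : ∫⁻ s' in Set.Icc (0:ℝ) 1, ∫⁻ t' in Set.Icc (0:ℝ) 1,
      ENNReal.ofReal ((dist (x s') (x t') / |t' - s'| ^ ((1:ℝ) / 2)) ^ (2 * k)) =
      besovEnergy k y := by
    refine setLIntegral_congr_fun measurableSet_Icc fun u hu => ?_
    refine setLIntegral_congr_fun measurableSet_Icc fun v hv => ?_
    simp only [hyx u hu, hyx v hv]
  rw [hE, ← hyx s ⟨hs, by linarith⟩, ← hyx t ⟨by linarith, ht⟩]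
  set h : ℝ := t - s with hh
  have hh0 : 0 < h := sub_pos.2 hst
  rcases eq_or_ne (besovEnergy k y) ⊤ with htop | hfin
  · rw [htop, ENNReal.top_rpow_of_pos (by positivity), ENNReal.mul_top (by simpa using hD0)]
    exact le_top
  have key : ∀ b : ℝ, 0 < b → besovEnergy k y ≤ ENNReal.ofReal b →
      dist (y s) (y t) / h ^ α ≤ 2 * D * b ^ ((1:ℝ) / (2 * k)) := by
    intro b hb hB
    have hmono : ∀ n : ℕ, h / 2 ^ (n + 1) ≤ h / 2 ^ n := fun n => by gcongr <;> norm_num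
    have hpos : ∀ n : ℕ, 0 < h / 2 ^ n := fun n => by positivity
    have hleft := lintegral_uniformIcc_edist_point_le hyc hk2' (a := fun _ => s) (z := s) hh0 hs
      (by linarith) (fun n => Set.Icc_subset_Icc le_rfl (by linarith [hmono n]))
      (fun n => ⟨le_rfl, by linarith [hpos n]⟩) hb hB
    have hright := lintegral_uniformIcc_edist_point_le hyc hk2' (a := fun n => t - h / 2 ^ n)
      (z := t) hh0 (by simp only [pow_zero]; linarith) (by simp only [pow_zero]; linarith)
      (fun n => Set.Icc_subset_Icc (by linarith [hmono n]) (by linarith))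
      (fun n => ⟨by linarith [hpos n], by linarith⟩) hb hB
    have e : t - h / 2 ^ 0 = s := by rw [hh]; ring
    simp only [e] at hright
    rw [← hγ, ← hD] at hleft hright
    have := isProbabilityMeasure_uniformIcc s hh0
    have hX : 0 ≤ D * (b ^ ((1:ℝ) / (2 * k)) * h ^ γ) := by positivity
    have hd : edist (y s) (y t) ≤
        ENNReal.ofReal (2 * (D * (b ^ ((1:ℝ) / (2 * k)) * h ^ γ))) :=
      calc edist (y s) (y t) = ∫⁻ _, edist (y s) (y t) ∂uniformIcc s h := by simp
        _ ≤ ∫⁻ u, (edist (y s) (y u) + edist (y t) (y u)) ∂uniformIcc s h :=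
            lintegral_mono fun u => edist_triangle_right _ _ _
        _ = _ := lintegral_add_left (continuous_const.edist hyc).measurable _
        _ ≤ _ := add_le_add hleft hright
        _ = _ := by rw [← ENNReal.ofReal_add hX hX, ← two_mul]
    rw [edist_dist, ENNReal.ofReal_le_ofReal_iff (by positivity)] at hd
    rw [div_le_iff₀ (by positivity)]
    refine hd.trans ?_
    have hhγ : h ^ γ ≤ h ^ α := Real.rpow_le_rpow_of_exponent_ge hh0 (by linarith) hγα
    calc 2 * (D * (b ^ ((1:ℝ) / (2 * k)) * h ^ γ))
        = 2 * D * b ^ ((1:ℝ) / (2 * k)) * h ^ γ := by ring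
      _ ≤ _ := by gcongr
  set b₀ : ℝ := (besovEnergy k y).toReal with hb₀
  have hlim : dist (y s) (y t) / h ^ α ≤ 2 * D * b₀ ^ ((1:ℝ) / (2 * k)) := by
    have hcont : Filter.Tendsto (fun b : ℝ => 2 * D * b ^ ((1:ℝ) / (2 * k))) (𝓝[>] b₀)
        (𝓝 (2 * D * b₀ ^ ((1:ℝ) / (2 * k)))) :=
      (((Real.continuous_rpow_const (by positivity)).tendsto b₀).const_mul
        (2 * D)).mono_left nhdsWithin_le_nhds
    refine ge_of_tendsto hcont ?_
    filter_upwards [self_mem_nhdsWithin] with b hb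
    have hb' : b₀ < b := hb
    exact key b (ENNReal.toReal_nonneg.trans_lt hb')
      ((ENNReal.le_ofReal_iff_toReal_le hfin (ENNReal.toReal_nonneg.trans hb'.le)).2 hb'.le)
  rw [← ENNReal.ofReal_toReal hfin, ENNReal.ofReal_rpow_of_nonneg ENNReal.toReal_nonneg
    (by positivity), ← ENNReal.ofReal_mul (by positivity)]
  exact ENNReal.ofReal_le_ofReal hlim
end

section
/- (Reparametrization of finite p-variation paths.) Let V be a Banach space, p ≥ 1, and let x : [0,1] → V be a continuous path of finite p-variation, i.e. |x|^p_{p-var} := sup_π Σ_i |x_{t_{i+1}} − x_{t_i}|^p < ∞, where the supremum is over all finite partitions π = {0 = t₀ < t₁ < ⋯ < t_n = 1} of [0,1]. Then there exist a continuous nondecreasing surjection σ : [0,1] → [0,1] and a (1/p)-Hölder continuous path y : [0,1] → V such that x_t = y(σ(t)) for all t ∈ [0,1] (with 1-Hölder meaning Lipschitz when p=1). -/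
open Set

/-- `IsPartitionSum φ s t r` says that `r` is the sum of `φ` over the consecutive pairs of points
of a finite partition `s = t₀ < t₁ < ⋯ < tₙ = t`. -/
inductive IsPartitionSum (φ : ℝ → ℝ → ℝ) (s : ℝ) : ℝ → ℝ → Prop
  | refl : IsPartitionSum φ s s 0
  | snoc {u r : ℝ} (t : ℝ) (h : IsPartitionSum φ s u r) (hut : u < t) :
      IsPartitionSum φ s t (r + φ u t)

namespace IsPartitionSum

variable {φ : ℝ → ℝ → ℝ} {s t u r r' : ℝ}

theorem le (h : IsPartitionSum φ s t r) : s ≤ t := by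
  induction h with
  | refl => exact le_rfl
  | snoc t _ hut ih => exact ih.trans hut.le

theorem eq_zero (h : IsPartitionSum φ s s r) : r = 0 := by
  cases h with
  | refl => rfl
  | snoc _ h hut => exact absurd h.le hut.not_ge

theorem single (h : s < t) : IsPartitionSum φ s t (φ s t) := by
  simpa using snoc t (refl (φ := φ) (s := s)) h

theorem append (h : IsPartitionSum φ s u r) (h' : IsPartitionSum φ u t r') :
    IsPartitionSum φ s t (r + r') := by
  induction h' with
  | refl => simpa using h
  | snoc t _ hut ih => simpa [add_assoc] using snoc t ih hut

theorem exists_first (h : IsPartitionSum φ s t r) (hst : s < t) :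
    ∃ u r', s < u ∧ IsPartitionSum φ u t r' ∧ r = φ s u + r' := by
  induction h with
  | refl => exact absurd hst (lt_irrefl s)
  | @snoc v r t h hvt ih =>
    rcases h.le.eq_or_lt with rfl | hsv
    · exact ⟨t, 0, hst, refl, by simp [h.eq_zero]⟩
    · obtain ⟨u, r', hsu, h', rfl⟩ := ih hsv
      exact ⟨u, r' + φ v t, hsu, snoc t h' hvt, by ring⟩

/-- Inserting a point into a partition costs at most the error in moving the right endpoint
of the interval that contains it. -/
theorem exists_split {b δ : ℝ} (hφ : ∀ a b, 0 ≤ φ a b) (hδ : 0 ≤ δ)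
    (h : IsPartitionSum φ s b r) (hst : s ≤ t) (htb : t ≤ b)
    (H : ∀ u v, s ≤ u → u ≤ t → t ≤ v → v ≤ b → φ u v ≤ φ u t + δ) :
    ∃ r₁ r₂, IsPartitionSum φ s t r₁ ∧ IsPartitionSum φ t b r₂ ∧ r ≤ r₁ + r₂ + δ := by
  induction h with
  | refl =>
    obtain rfl := le_antisymm hst htb
    exact ⟨0, 0, refl, refl, by simpa using hδ⟩
  | @snoc u r b h hub ih =>
    rcases le_or_gt t u with htu | hut
    · obtain ⟨r₁, r₂, h₁, h₂, hr⟩ := ih htu fun w v hsw hwt htv hvu =>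
        H w v hsw hwt htv (hvu.trans hub.le)
      exact ⟨r₁, r₂ + φ u b, h₁, snoc b h₂ hub, by linarith⟩
    · have hu := H u b h.le hut.le htb le_rfl
      rcases htb.eq_or_lt with rfl | htb
      · exact ⟨r + φ u t, 0, snoc t h hut, refl, by linarith⟩
      · exact ⟨r + φ u t, φ t b, snoc t h hut, single htb, by linarith [hφ t b]⟩

theorem exists_seq (h : IsPartitionSum φ s t r) :
    ∃ (n : ℕ) (tt : ℕ → ℝ), tt 0 = s ∧ tt n = t ∧ (∀ i < n, tt i < tt (i + 1)) ∧
      ∑ i ∈ Finset.range n, φ (tt i) (tt (i + 1)) = r := by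
  induction h with
  | refl => exact ⟨0, fun _ => s, rfl, rfl, by simp, by simp⟩
  | snoc t _ hut ih =>
    obtain ⟨n, tt, h0, hn, hlt, hsum⟩ := ih
    refine ⟨n + 1, fun i => if i ≤ n then tt i else t, by simpa using h0, by simp, ?_, ?_⟩
    · intro i hi
      rcases (Nat.lt_succ_iff.mp hi).eq_or_lt with rfl | hi
      · simpa [hn] using hut
      · simpa [hi.le, Nat.succ_le_of_lt hi] using hlt i hi
    · rw [Finset.sum_range_succ, ← hsum]
      congr 1
      · refine Finset.sum_congr rfl fun i hi => ?_
        have hi := Finset.mem_range.mp hi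
        simp [hi.le, Nat.succ_le_of_lt hi]
      · simp [hn]

end IsPartitionSum

/-- A two-parameter function on `[0,1]` is continuous in its second argument, uniformly in the
first. -/
def EquicontinuousRight (φ : ℝ → ℝ → ℝ) : Prop :=
  ∀ ε > 0, ∃ η > 0, ∀ u ∈ Icc (0 : ℝ) 1, ∀ v ∈ Icc (0 : ℝ) 1, ∀ w ∈ Icc (0 : ℝ) 1,
    |v - w| < η → φ u v ≤ φ u w + ε

theorem ContinuousOn.equicontinuousRight {φ : ℝ → ℝ → ℝ}
    (h : ContinuousOn (fun q : ℝ × ℝ => φ q.1 q.2) (Icc 0 1 ×ˢ Icc 0 1)) :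
    EquicontinuousRight φ := by
  intro ε hε
  obtain ⟨η, hη, H⟩ := Metric.uniformContinuousOn_iff.mp
    ((isCompact_Icc.prod isCompact_Icc).uniformContinuousOn_of_continuous h) ε hε
  refine ⟨η, hη, fun u hu v hv w hw hvw => ?_⟩
  have := H (u, v) ⟨hu, hv⟩ (u, w) ⟨hu, hw⟩ (by simpa [Prod.dist_eq, Real.dist_eq] using hvw)
  rw [Real.dist_eq] at this
  linarith [(abs_lt.mp this).2]

section Control

variable {φ : ℝ → ℝ → ℝ} {M : ℝ}

theorem IsPartitionSum.exists_right_le (hφ₀ : ∀ a, φ a a = 0) (hφc : EquicontinuousRight φ)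
    (hM : ∀ s t r, 0 ≤ s → t ≤ 1 → IsPartitionSum φ s t r → r ≤ M)
    {t : ℝ} (ht₀ : 0 ≤ t) (ht₁ : t < 1) {ε : ℝ} (hε : 0 < ε) :
    ∃ b, t < b ∧ b ≤ 1 ∧ ∀ r, IsPartitionSum φ t b r → r ≤ ε := by
  by_contra! H
  obtain ⟨η, hη, hφη⟩ := hφc (ε / 2) (half_pos hε)
  have step : ∀ n : ℕ, ∀ b, t < b → b ≤ 1 → b < t + η →
      ∃ r, IsPartitionSum φ t b r ∧ n * (ε / 2) ≤ r := by
    intro n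
    induction n with
    | zero =>
      intro b htb hb _
      obtain ⟨r, hr, hεr⟩ := H b htb hb
      exact ⟨r, hr, by simpa using (hε.trans hεr).le⟩
    | succ n ih =>
      intro b htb hb hbη
      obtain ⟨r, hr, hεr⟩ := H b htb hb
      obtain ⟨u, r', htu, hr', rfl⟩ := hr.exists_first htb
      have hub := hr'.le
      have hu := hφη t ⟨ht₀, ht₁.le⟩ u ⟨by linarith, by linarith⟩ t ⟨ht₀, ht₁.le⟩
        (abs_lt.mpr ⟨by linarith, by linarith⟩)
      rw [hφ₀ t] at hu
      obtain ⟨q, hq, hnq⟩ := ih u htu (by linarith) (by linarith)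
      refine ⟨q + r', hq.append hr', ?_⟩
      push_cast
      linarith
  obtain ⟨n, hn⟩ := exists_nat_gt (M / (ε / 2))
  obtain ⟨b, htb, hb⟩ := exists_between (lt_min ht₁ (lt_add_of_pos_right t hη))
  obtain ⟨r, hr, hnr⟩ := step n b htb (hb.trans_le (min_le_left _ _)).le
    (hb.trans_le (min_le_right _ _))
  have := hM t b r ht₀ (hb.trans_le (min_le_left _ _)).le hr
  rw [div_lt_iff₀ (half_pos hε)] at hn
  linarith

/-- The supremum of the partition sums of `φ` over the partitions of `[0,t]`. -/
noncomputable def supPartitionSum (φ : ℝ → ℝ → ℝ) (t : ℝ) : ℝ :=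
  sSup {r | IsPartitionSum φ 0 t r}

theorem supPartitionSum_le {t c : ℝ} (ht : 0 ≤ t) (h : ∀ r, IsPartitionSum φ 0 t r → r ≤ c) :
    supPartitionSum φ t ≤ c := by
  refine csSup_le ?_ h
  rcases ht.eq_or_lt with rfl | ht
  · exact ⟨0, .refl⟩
  · exact ⟨_, .single ht⟩

theorem IsPartitionSum.le_supPartitionSum
    (hM : ∀ s t r, 0 ≤ s → t ≤ 1 → IsPartitionSum φ s t r → r ≤ M)
    {t r : ℝ} (ht : t ≤ 1) (h : IsPartitionSum φ 0 t r) : r ≤ supPartitionSum φ t :=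
  le_csSup ⟨M, fun r hr => hM 0 t r le_rfl ht hr⟩ h

theorem le_supPartitionSum_sub (hφ₀ : ∀ a, φ a a = 0)
    (hM : ∀ s t r, 0 ≤ s → t ≤ 1 → IsPartitionSum φ s t r → r ≤ M)
    {s t : ℝ} (hs : 0 ≤ s) (hst : s ≤ t) (ht : t ≤ 1) :
    φ s t ≤ supPartitionSum φ t - supPartitionSum φ s := by
  rcases hst.eq_or_lt with rfl | hst
  · simp [hφ₀]
  · suffices supPartitionSum φ s ≤ supPartitionSum φ t - φ s t by linarith
    refine supPartitionSum_le hs fun r hr => ?_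
    linarith [(hr.snoc t hst).le_supPartitionSum hM ht]

theorem monotoneOn_supPartitionSum (hφ : ∀ a b, 0 ≤ φ a b) (hφ₀ : ∀ a, φ a a = 0)
    (hM : ∀ s t r, 0 ≤ s → t ≤ 1 → IsPartitionSum φ s t r → r ≤ M) :
    MonotoneOn (supPartitionSum φ) (Icc 0 1) := fun s hs t ht hst => by
  linarith [hφ s t, le_supPartitionSum_sub hφ₀ hM hs.1 hst ht.2]

theorem exists_supPartitionSum_right_le (hφ : ∀ a b, 0 ≤ φ a b) (hφ₀ : ∀ a, φ a a = 0)
    (hφc : EquicontinuousRight φ)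
    (hM : ∀ s t r, 0 ≤ s → t ≤ 1 → IsPartitionSum φ s t r → r ≤ M)
    {t : ℝ} (ht₀ : 0 ≤ t) (ht₁ : t < 1) {ε : ℝ} (hε : 0 < ε) :
    ∃ b, t < b ∧ b ≤ 1 ∧ supPartitionSum φ b ≤ supPartitionSum φ t + ε := by
  obtain ⟨c, htc, hc, hcε⟩ :=
    IsPartitionSum.exists_right_le hφ₀ hφc hM ht₀ ht₁ (half_pos hε)
  obtain ⟨η, hη, hφη⟩ := hφc (ε / 2) (half_pos hε)
  obtain ⟨b, htb, hb⟩ := exists_between (lt_min htc (lt_add_of_pos_right t hη))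
  have hbc := hb.trans_le (min_le_left _ _)
  have hbη := hb.trans_le (min_le_right _ _)
  refine ⟨b, htb, by linarith, supPartitionSum_le (by linarith) fun r hr => ?_⟩
  obtain ⟨r₁, r₂, h₁, h₂, hr⟩ := hr.exists_split hφ (half_pos hε).le ht₀ htb.le
    fun u v hu hut htv hvb => hφη u ⟨hu, by linarith⟩ v ⟨by linarith, by linarith⟩ t
      ⟨ht₀, ht₁.le⟩ (abs_lt.mpr ⟨by linarith, by linarith⟩)
  linarith [h₁.le_supPartitionSum hM ht₁.le, hcε _ (h₂.snoc c hbc), hφ b c]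

theorem exists_supPartitionSum_left_ge (hφc : EquicontinuousRight φ)
    (hM : ∀ s t r, 0 ≤ s → t ≤ 1 → IsPartitionSum φ s t r → r ≤ M)
    {t : ℝ} (ht₀ : 0 < t) (ht₁ : t ≤ 1) {ε : ℝ} (hε : 0 < ε) :
    ∃ a, 0 ≤ a ∧ a < t ∧ supPartitionSum φ t ≤ supPartitionSum φ a + ε := by
  obtain ⟨r, hr, hrt⟩ := exists_lt_of_lt_csSup (s := {r | IsPartitionSum φ 0 t r})
    ⟨_, .single ht₀⟩ (show supPartitionSum φ t - ε / 2 < _ from by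
      unfold supPartitionSum; linarith)
  obtain ⟨η, hη, hφη⟩ := hφc (ε / 2) (half_pos hε)
  cases hr with
  | refl => exact absurd ht₀ (lt_irrefl _)
  | @snoc u r _ hr hut =>
    obtain ⟨a, hua, hat⟩ := exists_between (max_lt hut (sub_lt_self t hη))
    have hu := hr.le
    have hua' := (le_max_left _ _).trans_lt hua
    have hηa := (le_max_right _ _).trans_lt hua
    have := hφη u ⟨hu, by linarith⟩ t ⟨ht₀.le, ht₁⟩ a ⟨by linarith, by linarith⟩
      (abs_lt.mpr ⟨by linarith, by linarith⟩)
    exact ⟨a, by linarith, hat,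
      by linarith [(hr.snoc a hua').le_supPartitionSum hM (by linarith)]⟩

theorem continuousOn_supPartitionSum (hφ : ∀ a b, 0 ≤ φ a b) (hφ₀ : ∀ a, φ a a = 0)
    (hφc : EquicontinuousRight φ)
    (hM : ∀ s t r, 0 ≤ s → t ≤ 1 → IsPartitionSum φ s t r → r ≤ M) :
    ContinuousOn (supPartitionSum φ) (Icc 0 1) := by
  have hmono := monotoneOn_supPartitionSum hφ hφ₀ hM
  rw [Metric.continuousOn_iff]
  intro t ht ε hε
  obtain ⟨b, htb, hb⟩ : ∃ b, t < b ∧ ∀ s ∈ Icc (0 : ℝ) 1, s < b →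
      supPartitionSum φ s ≤ supPartitionSum φ t + ε / 2 := by
    rcases ht.2.eq_or_lt with rfl | ht₁
    · exact ⟨2, by norm_num, fun s hs _ => by linarith [hmono hs ht hs.2]⟩
    · obtain ⟨b, htb, hb₁, hb⟩ :=
        exists_supPartitionSum_right_le hφ hφ₀ hφc hM ht.1 ht₁ (half_pos hε)
      exact ⟨b, htb, fun s hs hsb =>
        (hmono hs ⟨ht.1.trans htb.le, hb₁⟩ hsb.le).trans hb⟩
  obtain ⟨a, hat, ha⟩ : ∃ a, a < t ∧ ∀ s ∈ Icc (0 : ℝ) 1, a < s →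
      supPartitionSum φ t ≤ supPartitionSum φ s + ε / 2 := by
    rcases ht.1.eq_or_lt with rfl | ht₀
    · exact ⟨-1, by norm_num, fun s hs _ => by linarith [hmono ht hs hs.1]⟩
    · obtain ⟨a, ha₀, hat, ha⟩ :=
        exists_supPartitionSum_left_ge hφc hM ht₀ ht.2 (half_pos hε)
      exact ⟨a, hat, fun s hs has => by
        linarith [hmono ⟨ha₀, hat.le.trans ht.2⟩ hs has.le]⟩
  refine ⟨min (b - t) (t - a), lt_min (by linarith) (by linarith), fun s hs hst => ?_⟩
  rw [Real.dist_eq, lt_min_iff] at hst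
  have h₁ := abs_lt.mp hst.1
  have h₂ := abs_lt.mp hst.2
  have := hb s hs (by linarith)
  have := ha s hs (by linarith)
  rw [Real.dist_eq, abs_lt]
  constructor <;> linarith

end Control

theorem IsPartitionSum.le_of_forall_seq_sum_le {φ : ℝ → ℝ → ℝ} {M : ℝ} (hφ : ∀ a b, 0 ≤ φ a b)
    (hM : ∀ (n : ℕ) (tt : ℕ → ℝ), tt 0 = 0 → tt n = 1 → (∀ i < n, tt i < tt (i + 1)) →
      ∑ i ∈ Finset.range n, φ (tt i) (tt (i + 1)) ≤ M)
    {s t r : ℝ} (hs : 0 ≤ s) (ht : t ≤ 1) (h : IsPartitionSum φ s t r) : r ≤ M := by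
  obtain ⟨q, hq, hrq⟩ : ∃ q, IsPartitionSum φ 0 t q ∧ r ≤ q := by
    rcases hs.eq_or_lt with rfl | hs
    · exact ⟨r, h, le_rfl⟩
    · exact ⟨φ 0 s + r, (single hs).append h, by linarith [hφ 0 s]⟩
  obtain ⟨q', hq', hqq'⟩ : ∃ q', IsPartitionSum φ 0 1 q' ∧ q ≤ q' := by
    rcases ht.eq_or_lt with rfl | ht
    · exact ⟨q, hq, le_rfl⟩
    · exact ⟨q + φ t 1, hq.snoc 1 ht, by linarith [hφ t 1]⟩
  obtain ⟨n, tt, h0, h1, hlt, rfl⟩ := hq'.exists_seq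
  linarith [hM n tt h0 h1 hlt]

/-- **Reparametrization of finite `p`-variation paths.**  A continuous path
`x : [0,1] → V` of finite `p`-variation can be written `x = y ∘ σ` with
`σ : [0,1] → [0,1]` a continuous nondecreasing surjection and `y` a `(1/p)`-Hölder
continuous path. -/
theorem finite_pvariation_reparametrization
    {V : Type*} [NormedAddCommGroup V] [NormedSpace ℝ V] [CompleteSpace V]
    (p : ℝ) (hp : 1 ≤ p) (x : ℝ → V) (hx : ContinuousOn x (Set.Icc 0 1))
    (M : ℝ)
    (hvar : ∀ (n : ℕ) (tt : ℕ → ℝ), tt 0 = 0 → tt n = 1 → (∀ i < n, tt i < tt (i + 1)) →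
      ∑ i ∈ Finset.range n, ‖x (tt (i + 1)) - x (tt i)‖ ^ p ≤ M) :
    ∃ σ : ℝ → ℝ, ContinuousOn σ (Set.Icc 0 1) ∧ MonotoneOn σ (Set.Icc 0 1) ∧
      Set.MapsTo σ (Set.Icc 0 1) (Set.Icc 0 1) ∧
      Set.SurjOn σ (Set.Icc 0 1) (Set.Icc 0 1) ∧
      ∃ y : ℝ → V,
        (∃ K : ℝ, ∀ s t : ℝ, 0 ≤ s → s ≤ t → t ≤ 1 →
          ‖y t - y s‖ ≤ K * (t - s) ^ (1 / p)) ∧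
        ∀ t ∈ Set.Icc (0:ℝ) 1, x t = y (σ t) := by
  have hp₀ : 0 < p := by linarith
  set φ : ℝ → ℝ → ℝ := fun s t => ‖x t - x s‖ ^ p with hφ_def
  have hφ : ∀ a b, 0 ≤ φ a b := fun a b => by positivity
  have hφ₀ : ∀ a, φ a a = 0 := fun a => by simp [hφ_def, hp₀.ne']
  have hφc : EquicontinuousRight φ := by
    refine ContinuousOn.equicontinuousRight (ContinuousOn.rpow_const ?_ fun _ _ => .inr hp₀.le)
    exact ((hx.comp continuousOn_snd fun q hq => hq.2).sub
      (hx.comp continuousOn_fst fun q hq => hq.1)).norm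
  have hM : ∀ s t r, 0 ≤ s → t ≤ 1 → IsPartitionSum φ s t r → r ≤ M :=
    fun s t r hs ht h => h.le_of_forall_seq_sum_le hφ hvar hs ht
  set F := supPartitionSum φ
  have hFφ : ∀ s t, 0 ≤ s → s ≤ t → t ≤ 1 → φ s t ≤ F t - F s :=
    fun s t => le_supPartitionSum_sub hφ₀ hM
  have hFmono : MonotoneOn F (Icc 0 1) := monotoneOn_supPartitionSum hφ hφ₀ hM
  have hFcont : ContinuousOn F (Icc 0 1) := continuousOn_supPartitionSum hφ hφ₀ hφc hM
  have mem₀ : (0 : ℝ) ∈ Icc (0 : ℝ) 1 := ⟨le_rfl, zero_le_one⟩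
  have mem₁ : (1 : ℝ) ∈ Icc (0 : ℝ) 1 := ⟨zero_le_one, le_rfl⟩
  set C := 1 + (F 1 - F 0)
  have hC : 0 < C := by linarith [hFmono mem₀ mem₁ zero_le_one]
  set σ : ℝ → ℝ := fun t => (t + (F t - F 0)) / C with hσ_def
  have hσ₀ : σ 0 = 0 := by simp [hσ_def]
  have hσ₁ : σ 1 = 1 := div_self hC.ne'
  have hσcont : ContinuousOn σ (Icc 0 1) :=
    (continuousOn_id.add (hFcont.sub continuousOn_const)).div_const C
  have hσmono : StrictMonoOn σ (Icc 0 1) := fun s hs t ht hst =>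
    div_lt_div_of_pos_right (by linarith [hFmono hs ht hst.le]) hC
  have hσmaps : MapsTo σ (Icc 0 1) (Icc 0 1) := fun t ht =>
    ⟨hσ₀ ▸ hσmono.monotoneOn mem₀ ht ht.1, hσ₁ ▸ hσmono.monotoneOn ht mem₁ ht.2⟩
  have hσsurj : SurjOn σ (Icc 0 1) (Icc 0 1) := by
    have := intermediate_value_Icc zero_le_one hσcont
    rwa [hσ₀, hσ₁] at this
  refine ⟨σ, hσcont, hσmono.monotoneOn, hσmaps, hσsurj,
    x ∘ Function.invFunOn σ (Icc 0 1), ⟨C ^ (1 / p), fun s t hs hst ht => ?_⟩, fun t ht => ?_⟩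
  · obtain ⟨a, ha, rfl⟩ := hσsurj ⟨hs, hst.trans ht⟩
    obtain ⟨b, hb, rfl⟩ := hσsurj ⟨hs.trans hst, ht⟩
    have hab : a ≤ b := (hσmono.le_iff_le ha hb).mp hst
    rw [Function.comp_apply, Function.comp_apply, hσmono.injOn.leftInvOn_invFunOn ha,
      hσmono.injOn.leftInvOn_invFunOn hb, ← Real.mul_rpow hC.le (sub_nonneg.mpr hst), one_div,
      Real.le_rpow_inv_iff_of_pos (norm_nonneg _) (mul_nonneg hC.le (sub_nonneg.mpr hst)) hp₀]
    have : C * (σ b - σ a) = (b - a) + (F b - F a) := by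
      simp only [hσ_def]
      field_simp
      ring
    rw [this]
    linarith [hFφ a b ha.1 hab hb.2]
  · rw [Function.comp_apply, hσmono.injOn.leftInvOn_invFunOn ht]
end
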